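/- Let ℓ ≥ 1 and λ > 0 be fixed, and define the Zygmund norm using the Ditzian–Totik modulus of order r = 2ℓ (with λ ≤ 2ℓ). Let α, β > −1 with α + β + 1 ≥ 0, and let k : [0,1]×[0,1] → ℝ be continuous with sup_{s∈[0,1]} ‖k_s‖_{Z_λ} < ∞. Then there exists a constant C > 0, independent of m and f, such that for every f ∈ Z_λ and every m ≥ 1, sup_{s∈[0,1]} |(Vf)(s) − (V_m^{(ℓ)}f)(s)| ≤ C · (sup_{s∈[0,1]} ‖k_s‖_{Z_λ}) · ( m^{−λ/2} + m^{−ℓ} ) · ‖f‖_{Z_λ}. -/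

import Mathlib

open Set MeasureTheory

/-- Bernstein basis polynomial `p_{m,k}(x) = C(m,k) x^k (1-x)^(m-k)`. -/
noncomputable def bern (m k : ℕ) (x : ℝ) : ℝ :=
  (m.choose k : ℝ) * x ^ k * (1 - x) ^ (m - k)

/-- The Bernstein operator `B_m`. -/
noncomputable def Bop (m : ℕ) (f : ℝ → ℝ) : ℝ → ℝ :=
  fun x => ∑ k ∈ Finset.range (m + 1), bern m k x * f ((k : ℝ) / (m : ℝ))

/-- The generalized Bernstein operator `B_{m,ℓ} = I - (I - B_m)^ℓ`. -/
noncomputable def GBop (m l : ℕ) (f : ℝ → ℝ) : ℝ → ℝ :=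
  fun x => f x - ((fun g => g - Bop m g)^[l] f) x

/-- Fundamental generalized Bernstein polynomials
`p^{(ℓ)}_{m,j} = ∑_{i=1}^ℓ C(ℓ,i) (-1)^{i-1} B_m^{i-1}(p_{m,j})`. -/
noncomputable def gbBasis (m l j : ℕ) : ℝ → ℝ :=
  fun x => ∑ i ∈ Finset.Icc 1 l,
    (l.choose i : ℝ) * (-1 : ℝ) ^ (i - 1) * ((Bop m)^[i - 1] (bern m j) x)

/-- Sup norm on `[0,1]`. -/
noncomputable def supNorm (f : ℝ → ℝ) : ℝ := ⨆ x : Set.Icc (0 : ℝ) 1, |f (x : ℝ)|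

/-- `φ(x) = √(x(1-x))`. -/
noncomputable def phiDT (x : ℝ) : ℝ := Real.sqrt (x * (1 - x))

/-- Symmetric difference `Δ^r_{hφ} f(x)`. -/
noncomputable def dtDiff (r : ℕ) (h : ℝ) (f : ℝ → ℝ) (x : ℝ) : ℝ :=
  ∑ k ∈ Finset.range (r + 1),
    (-1 : ℝ) ^ k * (r.choose k : ℝ) * f (x + ((r : ℝ) - 2 * k) * (h / 2) * phiDT x)

/-- `x ∈ [0,1]` and all the nodes of `Δ^r_{hφ} f(x)` lie in `[0,1]`. -/
def dtAdmissible (r : ℕ) (h : ℝ) (x : ℝ) : Prop :=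
  x ∈ Set.Icc (0 : ℝ) 1 ∧
    ∀ k ≤ r, x + ((r : ℝ) - 2 * k) * (h / 2) * phiDT x ∈ Set.Icc (0 : ℝ) 1

/-- Ditzian–Totik modulus of smoothness `ω^r_φ(f,t)`. -/
noncomputable def omegaDT (r : ℕ) (f : ℝ → ℝ) (t : ℝ) : ℝ :=
  sSup {y | ∃ h x, 0 < h ∧ h ≤ t ∧ dtAdmissible r h x ∧ y = |dtDiff r h f x|}

/-- The set of quotients `ω^r_φ(f,t)/t^λ`, `t > 0`. -/
def zygSet (lam : ℝ) (r : ℕ) (f : ℝ → ℝ) : Set ℝ :=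
  {y | ∃ t : ℝ, 0 < t ∧ y = omegaDT r f t / t ^ lam}

/-- Membership in the Hölder–Zygmund space `Z_λ` (modulus of order `r`). -/
def memZ (lam : ℝ) (r : ℕ) (f : ℝ → ℝ) : Prop :=
  ContinuousOn f (Set.Icc 0 1) ∧ BddAbove (zygSet lam r f)

/-- The Zygmund norm `‖f‖_{Z_λ} = ‖f‖ + sup_{t>0} ω^r_φ(f,t)/t^λ`. -/
noncomputable def Znorm (lam : ℝ) (r : ℕ) (f : ℝ → ℝ) : ℝ :=
  supNorm f + sSup (zygSet lam r f)

/-- Volterra integral operator `(Vf)(s) = ∫_0^s k(t,s) f(t) (s-t)^α t^β dt`. -/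
noncomputable def Vop (alp bet : ℝ) (k : ℝ → ℝ → ℝ) (f : ℝ → ℝ) (s : ℝ) : ℝ :=
  ∫ t in (0 : ℝ)..s, k t s * f t * (s - t) ^ alp * t ^ bet

/-- Quadrature coefficients `Q^{(ℓ)}_j(s) = ∫_0^s p^{(ℓ)}_{m,j}(t)(s-t)^α t^β dt`. -/
noncomputable def Qcoef (alp bet : ℝ) (m l j : ℕ) (s : ℝ) : ℝ :=
  ∫ t in (0 : ℝ)..s, gbBasis m l j t * (s - t) ^ alp * t ^ bet

/-- Discrete Volterra operator `(V_m^{(ℓ)}f)(s) = ∑_j Q^{(ℓ)}_j(s) k(j/m,s) f(j/m)`. -/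
noncomputable def Vmop (alp bet : ℝ) (k : ℝ → ℝ → ℝ) (m l : ℕ) (f : ℝ → ℝ) (s : ℝ) : ℝ :=
  ∑ j ∈ Finset.range (m + 1),
    Qcoef alp bet m l j s * k ((j : ℝ) / (m : ℝ)) s * f ((j : ℝ) / (m : ℝ))

section FiniteDifferences

theorem hasDerivAt_iteratedDeriv {r : ℕ} {g : ℝ → ℝ} (hg : ContDiff ℝ r g) {n : ℕ} (hn : n < r)
    (x : ℝ) : HasDerivAt (iteratedDeriv n g) (iteratedDeriv (n + 1) g x) x := by
  rw [iteratedDeriv_succ]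
  exact ((hg.differentiable_iteratedDeriv n (by exact_mod_cast hn)) x).hasDerivAt

theorem fwdDiff_iter_succ_apply (h : ℝ) (n : ℕ) (g : ℝ → ℝ) (x : ℝ) :
    (fwdDiff h)^[n + 1] g x = (fwdDiff h)^[n] g (x + h) - (fwdDiff h)^[n] g x := by
  rw [Function.iterate_succ_apply']
  rfl

/-- Mean value theorem for iterated forward differences. -/
theorem exists_fwdDiff_iter_eq {h : ℝ} (hh : 0 ≤ h) (n : ℕ) :
    ∀ (g : ℝ → ℝ), ContDiff ℝ n g → ∀ x : ℝ,
      ∃ ξ ∈ Icc x (x + n * h), (fwdDiff h)^[n] g x = h ^ n * iteratedDeriv n g ξ := by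
  induction n with
  | zero => intro g _ x; exact ⟨x, by simp, by simp⟩
  | succ n ih =>
    intro g hg x
    have hgs : ContDiff ℝ n (fun y => g (y + h)) :=
      (hg.of_le (by exact_mod_cast n.le_succ)).comp (contDiff_id.add contDiff_const)
    have hg' : ContDiff ℝ n g := hg.of_le (by exact_mod_cast n.le_succ)
    obtain ⟨ξ, hξ, he⟩ := ih (fwdDiff h g) (hgs.sub hg') x
    have hD : iteratedDeriv n (fwdDiff h g) ξ
        = iteratedDeriv n g (ξ + h) - iteratedDeriv n g ξ := by
      have : fwdDiff h g = fun y => g (y + h) - g y := rfl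
      rw [this, iteratedDeriv_fun_sub hgs.contDiffAt hg'.contDiffAt, iteratedDeriv_comp_add_const]
    rcases hh.eq_or_lt with rfl | hpos
    · refine ⟨x, by simp, ?_⟩
      rw [Function.iterate_succ_apply, he, hD]; simp
    obtain ⟨ζ, hζ, hd⟩ := exists_hasDerivAt_eq_slope (iteratedDeriv n g) (iteratedDeriv (n + 1) g)
      (show ξ < ξ + h by linarith)
      (hg.continuous_iteratedDeriv n (by exact_mod_cast n.le_succ)).continuousOn
      (fun y _ => hasDerivAt_iteratedDeriv hg n.lt_succ_self y)
    refine ⟨ζ, ⟨hξ.1.trans hζ.1.le, ?_⟩, ?_⟩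
    · have := hξ.2; have := hζ.2; push_cast; linarith
    · rw [Function.iterate_succ_apply, he, hD, hd, add_sub_cancel_left, pow_succ]
      field_simp

theorem abs_fwdDiff_iter_le {h : ℝ} (hh : 0 ≤ h) {M : ℝ} (n : ℕ) :
    ∀ (g : ℝ → ℝ) (x : ℝ), (∀ y ∈ Icc x (x + n * h), |g y| ≤ M) →
      |(fwdDiff h)^[n] g x| ≤ 2 ^ n * M := by
  induction n with
  | zero => intro g x hg; simpa using hg x (by simp)
  | succ n ih =>
    intro g x hg
    rw [fwdDiff_iter_succ_apply]
    push_cast at hg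
    have h1 := ih g (x + h) fun y hy => hg y ⟨by linarith [hy.1], by linarith [hy.2]⟩
    have h2 := ih g x fun y hy => hg y ⟨by linarith [hy.1], by linarith [hy.2]⟩
    calc _ ≤ _ := abs_sub _ _
      _ ≤ 2 ^ (n + 1) * M := by rw [pow_succ]; linarith

theorem abs_sub_le_of_abs_deriv_le {g g' : ℝ → ℝ} {a b M : ℝ}
    (hg : ∀ x ∈ Icc a b, HasDerivAt g (g' x) x) (hM : ∀ x ∈ Icc a b, |g' x| ≤ M) {x y : ℝ}
    (hx : x ∈ Icc a b) (hy : y ∈ Icc a b) : |g y - g x| ≤ M * |y - x| := by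
  have := (convex_Icc a b).norm_image_sub_le_of_norm_hasDerivWithin_le (f := g) (f' := g')
    (fun z hz => (hg z hz).hasDerivWithinAt) hM hx hy
  simpa using this

/-- Interpolation of intermediate derivatives on an interval (Landau–Kolmogorov). -/
theorem exists_intermediate_deriv_bound (r : ℕ) : ∃ C : ℝ, 1 ≤ C ∧
    ∀ (u : ℝ → ℝ), ContDiff ℝ r u → ∀ a L M : ℝ, 0 < L → 0 ≤ M →
      (∀ x ∈ Icc a (a + L), |u x| ≤ M) →
      (∀ x ∈ Icc a (a + L), |iteratedDeriv r u x| ≤ M / L ^ r) →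
      ∀ n ≤ r, ∀ x ∈ Icc a (a + L), |iteratedDeriv n u x| ≤ C * M / L ^ n := by
  have key : ∀ j ≤ r, ∃ C : ℝ, 1 ≤ C ∧
    ∀ (u : ℝ → ℝ), ContDiff ℝ r u → ∀ a L M : ℝ, 0 < L → 0 ≤ M →
      (∀ x ∈ Icc a (a + L), |u x| ≤ M) →
      (∀ x ∈ Icc a (a + L), |iteratedDeriv r u x| ≤ M / L ^ r) →
      ∀ n ≤ r, r - j ≤ n → ∀ x ∈ Icc a (a + L), |iteratedDeriv n u x| ≤ C * M / L ^ n := by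
    intro j
    induction j with
    | zero =>
      intro _
      refine ⟨1, le_rfl, fun u _ a L M _ _ _ hr n hn hn' x hx => ?_⟩
      obtain rfl : n = r := by omega
      simpa using hr x hx
    | succ j ih =>
      intro hj
      obtain ⟨C, hC, H⟩ := ih (by omega)
      set q := r - (j + 1) with hq
      refine ⟨C + (2 * q) ^ q, by nlinarith [show (0:ℝ) ≤ (2 * q) ^ q by positivity], ?_⟩
      intro u hu a L M hL hM h0 hr n hn hqn x hx
      have hle : ∀ k : ℕ, C * M / L ^ k ≤ (C + (2 * q) ^ q) * M / L ^ k := fun k => by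
        gcongr
        have : (0:ℝ) ≤ (2 * q) ^ q := by positivity
        linarith
      rcases hqn.lt_or_eq with hlt | rfl
      · exact (H u hu a L M hL hM h0 hr n hn (by omega) x hx).trans (hle n)
      · have huq : ContDiff ℝ q u := hu.of_le (by exact_mod_cast hn)
        have hh : 0 ≤ L / q := by positivity
        have hqL : (q : ℝ) * (L / q) ≤ L := by
          rcases Nat.eq_zero_or_pos q with h | h
          · simp [h, hL.le]
          · have : (0:ℝ) < q := by exact_mod_cast h
            rw [mul_div_cancel₀ _ this.ne']
        obtain ⟨ξ, hξ, he⟩ := exists_fwdDiff_iter_eq hh q u huq a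
        have hξ' : ξ ∈ Icc a (a + L) := ⟨hξ.1, hξ.2.trans (by linarith)⟩
        have hb := abs_fwdDiff_iter_le hh q u a (M := M)
          fun y hy => h0 y ⟨hy.1, hy.2.trans (by linarith)⟩
        have h1 : |iteratedDeriv q u ξ| ≤ (2 * q) ^ q * M / L ^ q := by
          rcases Nat.eq_zero_or_pos q with h | h
          · rw [h] at he hb ⊢
            simpa using h0 ξ hξ'
          · have hqp : (0:ℝ) < q := by exact_mod_cast h
            rw [he, abs_mul, abs_of_nonneg (pow_nonneg hh q), div_pow] at hb
            rw [le_div_iff₀ (by positivity), mul_pow]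
            have := mul_le_mul_of_nonneg_left hb (show (0:ℝ) ≤ (q:ℝ) ^ q by positivity)
            field_simp at this
            nlinarith
        have h2 := abs_sub_le_of_abs_deriv_le (a := a) (b := a + L)
          (fun z _ => hasDerivAt_iteratedDeriv hu (show q < r by omega) z)
          (fun z hz => H u hu a L M hL hM h0 hr (q + 1) (by omega) (by omega) z hz) hξ' hx
        have h3 : |x - ξ| ≤ L := by
          rw [abs_le]; constructor <;> linarith [hx.1, hx.2, hξ'.1, hξ'.2]
        have h4 : C * M / L ^ (q + 1) * |x - ξ| ≤ C * M / L ^ q := by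
          calc _ ≤ C * M / L ^ (q + 1) * L := by gcongr
            _ = _ := by rw [pow_succ]; field_simp
        have h5 := abs_sub_abs_le_abs_sub (iteratedDeriv q u x) (iteratedDeriv q u ξ)
        rw [add_mul, add_div]
        linarith
  obtain ⟨C, hC, H⟩ := key r le_rfl
  exact ⟨C, hC, fun u hu a L M hL hM h0 hr n hn => H u hu a L M hL hM h0 hr n hn (by omega)⟩

/-- Leibniz bound for functions whose derivatives scale like powers of `1 / κ`. -/
theorem abs_iteratedDeriv_mul_le {u v : ℝ → ℝ} {n : ℕ} (hu : ContDiff ℝ n u) (hv : ContDiff ℝ n v)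
    {x κ A B : ℝ} (hκ : 0 < κ) (hA : ∀ i ≤ n, |iteratedDeriv i u x| ≤ A / κ ^ i)
    (hB : ∀ i ≤ n, |iteratedDeriv i v x| ≤ B / κ ^ i) :
    |iteratedDeriv n (fun y => u y * v y) x| ≤ 2 ^ n * (A * B) / κ ^ n := by
  have hA0 : 0 ≤ A := by simpa using (abs_nonneg _).trans (hA 0 n.zero_le)
  rw [show (fun y => u y * v y) = u * v from rfl, iteratedDeriv_mul hu.contDiffAt hv.contDiffAt]
  calc _ ≤ ∑ i ∈ Finset.range (n + 1), (n.choose i : ℝ) * (A * B / κ ^ n) := by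
        refine (Finset.abs_sum_le_sum_abs _ _).trans (Finset.sum_le_sum fun i hi => ?_)
        have hi' : i ≤ n := by simpa [Nat.lt_succ_iff] using hi
        rw [abs_mul, abs_mul, Nat.abs_cast, mul_assoc]
        gcongr
        calc _ ≤ A / κ ^ i * (B / κ ^ (n - i)) :=
              mul_le_mul (hA i hi') (hB _ (Nat.sub_le _ _)) (abs_nonneg _) (by positivity)
          _ = A * B / κ ^ n := by
              rw [div_mul_div_comm, ← pow_add, Nat.add_sub_cancel' hi']
    _ = _ := by
        rw [← Finset.sum_mul]
        have := Nat.sum_range_choose n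
        rw [show (∑ i ∈ Finset.range (n + 1), (n.choose i : ℝ)) = 2 ^ n by exact_mod_cast this]
        ring

end FiniteDifferences

section BernsteinSmooth

/-- The Bernstein-type polynomial with coefficient sequence `c`. -/
noncomputable def bernSum (M : ℕ) (c : ℕ → ℝ) (x : ℝ) : ℝ :=
  ∑ k ∈ Finset.range (M + 1), bern M k x * c k

theorem bern_eq_eval (m k : ℕ) (x : ℝ) : bern m k x = (bernsteinPolynomial ℝ m k).eval x := by
  simp [bern, bernsteinPolynomial]

theorem bern_nonneg (m k : ℕ) {x : ℝ} (hx : x ∈ Icc (0 : ℝ) 1) : 0 ≤ bern m k x := by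
  have h0 := hx.1
  have h1 : 0 ≤ 1 - x := by linarith [hx.2]
  unfold bern; positivity

theorem sum_bern (m : ℕ) (x : ℝ) : ∑ k ∈ Finset.range (m + 1), bern m k x = 1 := by
  simp_rw [bern_eq_eval, ← Polynomial.eval_finsetSum, bernsteinPolynomial.sum, Polynomial.eval_one]

theorem sum_bern_mul_id (m : ℕ) (x : ℝ) :
    ∑ k ∈ Finset.range (m + 1), bern m k x * (k : ℝ) = m * x := by
  have := congrArg (Polynomial.eval x) (bernsteinPolynomial.sum_smul ℝ m)
  simp only [Polynomial.eval_finsetSum, nsmul_eq_mul, Polynomial.eval_mul,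
    Polynomial.eval_natCast, Polynomial.eval_X] at this
  rw [← this]
  exact Finset.sum_congr rfl fun k _ => by rw [bern_eq_eval, mul_comm]

theorem contDiff_bern {n : WithTop ℕ∞} (m k : ℕ) : ContDiff ℝ n (bern m k) := by
  unfold bern; fun_prop

theorem contDiff_bernSum {n : WithTop ℕ∞} (M : ℕ) (c : ℕ → ℝ) : ContDiff ℝ n (bernSum M c) := by
  unfold bernSum
  exact ContDiff.sum fun k _ => (contDiff_bern M k).mul contDiff_const

theorem deriv_bernSum_succ (M : ℕ) (c : ℕ → ℝ) :
    deriv (bernSum (M + 1) c) = fun x => (M + 1 : ℝ) * bernSum M (fwdDiff 1 c) x := by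
  funext x
  have hd : ∀ k, HasDerivAt (bern (M + 1) k)
      ((Polynomial.derivative (bernsteinPolynomial ℝ (M + 1) k)).eval x) x := fun k => by
    rw [show bern (M + 1) k = fun x => (bernsteinPolynomial ℝ (M + 1) k).eval x from
      funext (bern_eq_eval _ _)]
    exact Polynomial.hasDerivAt _ x
  have h := HasDerivAt.fun_sum (u := Finset.range (M + 1 + 1)) (x := x)
    fun k _ => (hd k).mul_const (c k)
  have h' : deriv (bernSum (M + 1) c) x = _ := h.deriv
  rw [h', Finset.sum_range_succ']
  simp only [bernsteinPolynomial.derivative_succ, bernsteinPolynomial.derivative_zero,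
    Polynomial.eval_mul, Polynomial.eval_sub, Polynomial.eval_neg, Polynomial.eval_natCast,
    Nat.add_sub_cancel, ← bern_eq_eval, bernSum, fwdDiff]
  have hlast : bern M (M + 1) x = 0 := by simp [bern]
  have hs : ∑ k ∈ Finset.range (M + 1), bern M (k + 1) x * c (k + 1) + bern M 0 x * c 0
      = ∑ k ∈ Finset.range (M + 1), bern M k x * c k := by
    rw [← Finset.sum_range_succ' (fun k => bern M k x * c k), Finset.sum_range_succ, hlast]
    ring
  have e1 : ∀ k, ((M + 1 : ℕ) : ℝ) * (bern M k x - bern M (k + 1) x) * c (k + 1)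
      = (M + 1 : ℝ) * (bern M k x * c (k + 1)) - (M + 1 : ℝ) * (bern M (k + 1) x * c (k + 1)) :=
    fun k => by push_cast; ring
  simp_rw [e1, mul_sub, Finset.sum_sub_distrib, ← hs, ← Finset.mul_sum]
  push_cast
  ring

theorem iteratedDeriv_bernSum (n : ℕ) : ∀ (M : ℕ) (c : ℕ → ℝ),
    iteratedDeriv n (bernSum (M + n) c)
      = fun x => ((M + n).descFactorial n : ℝ) * bernSum M ((fwdDiff 1)^[n] c) x := by
  induction n with
  | zero => intro M c; funext x; simp
  | succ n ih =>
    intro M c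
    funext x
    rw [iteratedDeriv_succ', ← add_assoc, deriv_bernSum_succ,
      iteratedDeriv_const_mul_field, ih M, Nat.succ_descFactorial_succ]
    push_cast
    rw [Function.iterate_succ_apply]
    ring

theorem fwdDiff_iter_comp_div (g : ℝ → ℝ) (d : ℝ) (n : ℕ) : ∀ k : ℕ,
    (fwdDiff 1)^[n] (fun k : ℕ => g (k / d)) k = (fwdDiff (1 / d))^[n] g (k / d) := by
  induction n with
  | zero => intro k; rfl
  | succ n ih =>
    intro k
    rw [fwdDiff_iter_succ_apply, Function.iterate_succ_apply', fwdDiff, ih, ih]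
    push_cast
    rw [add_div]

/-- The weight `min(x, 1 - x) + 1 / m`. -/
noncomputable def bw (m : ℕ) (x : ℝ) : ℝ := min x (1 - x) + 1 / m

theorem bw_ge {m : ℕ} {x : ℝ} (hx : x ∈ Icc (0 : ℝ) 1) : 1 / (m : ℝ) ≤ bw m x := by
  have : 0 ≤ min x (1 - x) := le_min hx.1 (by linarith [hx.2])
  unfold bw; linarith

theorem bw_pos {m : ℕ} (hm : 1 ≤ m) {x : ℝ} (hx : x ∈ Icc (0 : ℝ) 1) : 0 < bw m x :=
  lt_of_lt_of_le (by positivity) (bw_ge hx)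

theorem bw_le_two {m : ℕ} (hm : 1 ≤ m) {x : ℝ} (hx : x ∈ Icc (0 : ℝ) 1) : bw m x ≤ 2 := by
  have h1 : min x (1 - x) ≤ 1 := (min_le_left _ _).trans hx.2
  have h2 : 1 / (m : ℝ) ≤ 1 := by
    rw [div_le_one (by positivity)]; exact_mod_cast hm
  unfold bw; linarith

theorem mul_one_sub_le_bw (m : ℕ) {x : ℝ} (hx : x ∈ Icc (0 : ℝ) 1) : x * (1 - x) ≤ bw m x := by
  have h0 := hx.1
  have h1 := hx.2
  have : x * (1 - x) ≤ min x (1 - x) := le_min (by nlinarith) (by nlinarith)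
  have h2 : (0 : ℝ) ≤ 1 / m := by positivity
  unfold bw; linarith

theorem bw_sub_le (m : ℕ) (x y : ℝ) : bw m x - bw m y ≤ |y - x| := by
  have h : min x (1 - x) ≤ min y (1 - y) + |y - x| := by
    rw [← min_add_add_right]
    have h1 := neg_abs_le (y - x)
    have h2 := le_abs_self (y - x)
    exact min_le_min (by linarith) (by linarith)
  unfold bw; linarith

theorem bw_le_mul {m : ℕ} (hm : 1 ≤ m) {x y : ℝ} (hx : x ∈ Icc (0 : ℝ) 1)
    (hy : y ∈ Icc (0 : ℝ) 1) :
    bw m x ≤ (2 + 4 * (m * (y - x) ^ 2 / bw m x)) * bw m y := by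
  have hX := bw_pos hm hx
  have hY := bw_pos hm hy
  have hm' : (0 : ℝ) < m := by positivity
  have hb : 0 ≤ m * (y - x) ^ 2 / bw m x := by positivity
  by_cases h : bw m x ≤ 2 * bw m y
  · nlinarith
  · have h1 : bw m x / 2 ≤ |y - x| := by linarith [bw_sub_le m x y]
    have h2 : (bw m x) ^ 2 ≤ 4 * (y - x) ^ 2 := by
      rw [← sq_abs (y - x)]; nlinarith
    have h3 : (m : ℝ) * bw m x ≤ 4 * (m * (y - x) ^ 2 / bw m x) := by
      rw [← mul_div_assoc, le_div_iff₀ hX]; nlinarith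
    have h4 : 1 ≤ m * bw m y := by
      have := bw_ge (m := m) hy
      rw [div_le_iff₀ hm'] at this; linarith
    calc bw m x ≤ bw m x * (m * bw m y) := le_mul_of_one_le_right hX.le h4
      _ = (m * bw m x) * bw m y := by ring
      _ ≤ _ := by gcongr; linarith

theorem min_bw_le (m : ℕ) {x y z : ℝ} (hz : z ∈ uIcc x y) : min (bw m x) (bw m y) ≤ bw m z := by
  unfold bw
  rw [min_add_add_right]
  suffices h : min (min x (1 - x)) (min y (1 - y)) ≤ min z (1 - z) by linarith
  rcases mem_uIcc.1 hz with h | h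
  · refine le_min ?_ ?_
    · exact (min_le_left _ _).trans ((min_le_left _ _).trans h.1)
    · exact (min_le_right _ _).trans ((min_le_right _ _).trans (by linarith [h.2]))
  · refine le_min ?_ ?_
    · exact (min_le_right _ _).trans ((min_le_left _ _).trans h.1)
    · exact (min_le_left _ _).trans ((min_le_right _ _).trans (by linarith [h.2]))

theorem sum_bern_mul_exp_le (M : ℕ) {x u : ℝ} (hx : x ∈ Icc (0 : ℝ) 1) (hu : |u| ≤ 1) :
    ∑ k ∈ Finset.range (M + 1), bern M k x * Real.exp (u * (k - M * x))
      ≤ Real.exp (M * (x * (1 - x)) * u ^ 2) := by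
  have h0 := hx.1
  have h1 : 0 ≤ 1 - x := by linarith [hx.2]
  obtain ⟨hu1, hu2⟩ := abs_le.1 hu
  have e : ∑ k ∈ Finset.range (M + 1), bern M k x * Real.exp (u * (k - M * x))
      = (x * Real.exp (u * (1 - x)) + (1 - x) * Real.exp (-(u * x))) ^ M := by
    rw [add_pow]
    refine Finset.sum_congr rfl fun k hk => ?_
    have hk' : k ≤ M := by simpa [Nat.lt_succ_iff] using hk
    rw [mul_pow, mul_pow, ← Real.exp_nat_mul, ← Real.exp_nat_mul]
    have : Real.exp (u * (k - M * x))
        = Real.exp (k * (u * (1 - x))) * Real.exp (((M - k : ℕ) : ℝ) * -(u * x)) := by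
      rw [← Real.exp_add]; congr 1; push_cast [Nat.cast_sub hk']; ring
    rw [this, bern]; ring
  have hexp : ∀ v : ℝ, |v| ≤ 1 → Real.exp v ≤ 1 + v + v ^ 2 := fun v hv => by
    have := (abs_le.1 (Real.abs_exp_sub_one_sub_id_le hv)).2
    linarith
  have b1 := hexp (u * (1 - x)) (by
    rw [abs_mul, abs_of_nonneg h1]; nlinarith [abs_nonneg u])
  have b2 := hexp (-(u * x)) (by
    rw [abs_neg, abs_mul, abs_of_nonneg h0]; nlinarith [abs_nonneg u, hx.2])
  have hb : x * Real.exp (u * (1 - x)) + (1 - x) * Real.exp (-(u * x))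
      ≤ Real.exp (x * (1 - x) * u ^ 2) := by
    calc _ ≤ x * (1 + u * (1 - x) + (u * (1 - x)) ^ 2)
          + (1 - x) * (1 + -(u * x) + (-(u * x)) ^ 2) := by gcongr
      _ = x * (1 - x) * u ^ 2 + 1 := by ring
      _ ≤ _ := Real.add_one_le_exp _
  rw [e]
  calc _ ≤ Real.exp (x * (1 - x) * u ^ 2) ^ M := by gcongr
    _ = _ := by rw [← Real.exp_nat_mul]; congr 1; ring

theorem one_add_pow_le_exp (q : ℕ) {a : ℝ} (ha : 0 ≤ a) :
    (1 + a) ^ q ≤ q.factorial * Real.exp 1 * Real.exp a := by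
  have := Real.pow_div_factorial_le_exp (1 + a) (by positivity) q
  rw [div_le_iff₀ (by positivity), Real.exp_add] at this
  linarith

/-- Moments of the binomial distribution at the natural scale. -/
theorem sum_bern_mul_pow_le (q : ℕ) {M m : ℕ} (hm : 1 ≤ m) (hM : M ≤ m) {x : ℝ}
    (hx : x ∈ Icc (0 : ℝ) 1) :
    ∑ k ∈ Finset.range (M + 1), bern M k x * (1 + |(k : ℝ) - M * x| / √(m * bw m x)) ^ q
      ≤ q.factorial * Real.exp 1 * (2 * Real.exp 1) := by
  set s := √(m * bw m x) with hs
  have hm' : (0 : ℝ) < m := by positivity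
  have hX := bw_pos hm hx
  have h1 : 1 ≤ m * bw m x := by
    have := bw_ge (m := m) hx
    rw [div_le_iff₀ hm'] at this; linarith
  have hs1 : 1 ≤ s := by rw [hs]; exact Real.one_le_sqrt.2 h1
  have hs2 : s ^ 2 = m * bw m x := Real.sq_sqrt (by positivity)
  have hinv : |1 / s| ≤ 1 := by
    rw [abs_of_nonneg (by positivity), div_le_one (by linarith)]; exact hs1
  have hE : Real.exp (M * (x * (1 - x)) * (1 / s) ^ 2) ≤ Real.exp 1 := by
    apply Real.exp_le_exp.2
    rw [div_pow, hs2, one_pow, mul_one_div, div_le_one (by positivity)]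
    have : (M : ℝ) ≤ m := by exact_mod_cast hM
    have h2 := mul_one_sub_le_bw m hx
    calc (M : ℝ) * (x * (1 - x)) ≤ M * bw m x := by gcongr
      _ ≤ _ := by gcongr
  have e1 := (sum_bern_mul_exp_le M hx hinv).trans hE
  have e2 := (sum_bern_mul_exp_le M (u := -(1 / s)) hx (by rwa [abs_neg])).trans
    (le_of_eq_of_le (by rw [neg_sq]) hE)
  calc _ ≤ ∑ k ∈ Finset.range (M + 1), q.factorial * Real.exp 1 *
        (bern M k x * Real.exp (1 / s * (k - M * x))
          + bern M k x * Real.exp (-(1 / s) * (k - M * x))) := by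
        refine Finset.sum_le_sum fun k _ => ?_
        have hb := bern_nonneg M k hx
        have h3 := one_add_pow_le_exp q (a := |(k : ℝ) - M * x| / s) (by positivity)
        have h4 : Real.exp (|(k : ℝ) - M * x| / s) ≤ Real.exp (1 / s * (k - M * x))
            + Real.exp (-(1 / s) * (k - M * x)) := by
          rcases abs_cases ((k : ℝ) - M * x) with h | h
          · rw [h.1]
            have : Real.exp ((k - M * x) / s) = Real.exp (1 / s * (k - M * x)) := by
              congr 1; ring
            rw [this]; linarith [Real.exp_pos (-(1 / s) * (k - M * x))]
          · rw [h.1]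
            have : Real.exp (-(k - M * x) / s) = Real.exp (-(1 / s) * (k - M * x)) := by
              congr 1; ring
            rw [this]; linarith [Real.exp_pos (1 / s * (k - M * x))]
        calc _ ≤ bern M k x * (q.factorial * Real.exp 1 * (Real.exp (1 / s * (k - M * x))
            + Real.exp (-(1 / s) * (k - M * x)))) := by
              gcongr
              exact h3.trans (by gcongr)
          _ = _ := by ring
    _ ≤ _ := by
        rw [← Finset.mul_sum, Finset.sum_add_distrib]
        gcongr
        linarith

theorem abs_taylor_two_le {h h' h'' : ℝ → ℝ} {x y S : ℝ}
    (hh : ∀ z, HasDerivAt h (h' z) z) (hh' : ∀ z, HasDerivAt h' (h'' z) z)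
    (hS : ∀ z ∈ uIcc x y, |h'' z| ≤ S) :
    |h y - h x - h' x * (y - x)| ≤ S * (y - x) ^ 2 := by
  have hS0 : 0 ≤ S := (abs_nonneg _).trans (hS x left_mem_uIcc)
  have h1 : ∀ z ∈ uIcc x y, |h' z - h' x| ≤ S * |y - x| := fun z hz =>
    (abs_sub_le_of_abs_deriv_le (fun z _ => hh' z) hS left_mem_uIcc hz).trans
      (mul_le_mul_of_nonneg_left (abs_sub_left_of_mem_uIcc hz) hS0)
  have h2 := abs_sub_le_of_abs_deriv_le (g := fun z => h z - h' x * z) (g' := fun z => h' z - h' x)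
    (fun z _ => by simpa using! (hh z).sub ((hasDerivAt_id z).const_mul (h' x)))
    h1 left_mem_uIcc right_mem_uIcc
  rw [← sq_abs (y - x)]
  calc _ = |h y - h' x * y - (h x - h' x * x)| := by congr 1; ring
    _ ≤ _ := h2
    _ = _ := by ring

theorem one_sub_descFactorial_div_le {m : ℕ} (hm : 1 ≤ m) (n : ℕ) (hn : n ≤ m) :
    1 - (m.descFactorial n : ℝ) / m ^ n ≤ n * n / m := by
  have hm' : (0 : ℝ) < m := by positivity
  induction n with
  | zero => simp
  | succ n ih =>
    have ih' := ih (by omega)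
    have hq : (m.descFactorial n : ℝ) / m ^ n ≤ 1 := by
      rw [div_le_one (by positivity)]; exact_mod_cast Nat.descFactorial_le_pow m n
    have e : (m.descFactorial (n + 1) : ℝ) / m ^ (n + 1)
        = (m.descFactorial n : ℝ) / m ^ n * (1 - n / m) := by
      rw [Nat.descFactorial_succ, pow_succ]
      push_cast [Nat.cast_sub (show n ≤ m by omega)]
      field_simp
    have h2 : (0 : ℝ) ≤ n / m := by positivity
    have h3 : (((n + 1 : ℕ) : ℝ)) * ((n + 1 : ℕ) : ℝ) / m = n * n / m + 2 * (n / m) + 1 / m := by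
      push_cast; field_simp; ring
    have h4 : (0 : ℝ) ≤ 1 / m := by positivity
    rw [e, h3]
    nlinarith

end BernsteinSmooth

section BernsteinSmoothMain

theorem Bop_eq_bernSum (m : ℕ) (g : ℝ → ℝ) : Bop m g = bernSum m fun k => g (k / m) := rfl

theorem contDiff_Bop {n : WithTop ℕ∞} (m : ℕ) (g : ℝ → ℝ) : ContDiff ℝ n (Bop m g) :=
  contDiff_bernSum _ _

/-- The derivatives of a Bernstein polynomial as averages of derivatives of the function. -/
theorem exists_iteratedDeriv_Bop_eq {m n : ℕ} (hm : 1 ≤ m) (hn : n ≤ m) {g : ℝ → ℝ}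
    (hg : ContDiff ℝ n g) :
    ∃ ξ : ℕ → ℝ, (∀ k ≤ m - n, ξ k ∈ Icc ((k : ℝ) / m) ((k + n) / m)) ∧
      ∀ x, iteratedDeriv n (Bop m g) x = (m.descFactorial n : ℝ) / m ^ n *
        ∑ k ∈ Finset.range (m - n + 1), bern (m - n) k x * iteratedDeriv n g (ξ k) := by
  have hm' : (0 : ℝ) < m := by positivity
  have H : ∀ k : ℕ, ∃ ξ ∈ Icc ((k : ℝ) / m) (k / m + n * (1 / m)),
      (fwdDiff (1 / (m : ℝ)))^[n] g (k / m) = (1 / (m : ℝ)) ^ n * iteratedDeriv n g ξ :=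
    fun k => exists_fwdDiff_iter_eq (by positivity) n g hg _
  choose ξ h1 h2 using H
  refine ⟨ξ, fun k _ => ⟨(h1 k).1, (h1 k).2.trans (by rw [add_div]; simp [div_eq_mul_inv])⟩,
    fun x => ?_⟩
  obtain ⟨M, rfl⟩ : ∃ M, m = M + n := ⟨m - n, by omega⟩
  rw [Bop_eq_bernSum, iteratedDeriv_bernSum n M, Nat.add_sub_cancel, div_mul_eq_mul_div,
    mul_div_assoc]
  simp only [bernSum]
  rw [Finset.sum_div]
  congr 1
  refine Finset.sum_congr rfl fun k _ => ?_
  rw [fwdDiff_iter_comp_div, h2, one_div, inv_pow]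
  field_simp

theorem remainder_poly_bound {b a : ℝ} {n p P r : ℕ} (hb0 : 0 ≤ b) (ha : 0 ≤ a)
    (hb : b ≤ (a + 2 * n) ^ 2) (hn : n ≤ r) (hp : p ≤ P) :
    b * (1 + (2 + 4 * b) ^ p) ≤ 2 * (6 * (2 * r + 1) ^ 2) ^ (P + 1) * (1 + a) ^ (2 * (P + 1)) := by
  have hn' : (n : ℝ) ≤ r := by exact_mod_cast hn
  set G : ℝ := 6 * (2 * r + 1) ^ 2 * (1 + a) ^ 2 with hG
  have h1 : a + 2 * n ≤ (2 * r + 1) * (1 + a) := by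
    have : 0 ≤ r * a := by positivity
    nlinarith
  have h2 : b ≤ ((2 * r + 1) * (1 + a)) ^ 2 := hb.trans (by gcongr)
  have h3 : 1 ≤ ((2 * r + 1) * (1 + a)) ^ 2 := by
    apply one_le_pow₀
    have : (0 : ℝ) ≤ r := by positivity
    nlinarith
  have hG' : G = 6 * ((2 * r + 1) * (1 + a)) ^ 2 := by rw [hG]; ring
  have h4 : 2 + 4 * b ≤ G := by rw [hG']; linarith
  have h5 : b ≤ G := by linarith
  have hG1 : 1 ≤ G := by linarith
  calc b * (1 + (2 + 4 * b) ^ p) ≤ G * (G ^ P + G ^ P) := by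
        gcongr
        · exact one_le_pow₀ hG1
        · exact (pow_le_pow_left₀ (by positivity) h4 p).trans (pow_le_pow_right₀ hG1 hp)
    _ = 2 * G ^ (P + 1) := by ring
    _ = _ := by rw [hG, mul_pow, ← pow_mul]; ring

set_option maxHeartbeats 1000000 in
theorem abs_iteratedDeriv_sub_Bop_le (P r : ℕ) : ∃ C : ℝ, 0 ≤ C ∧
    ∀ m : ℕ, 1 ≤ m → r ≤ m → ∀ g : ℝ → ℝ, ContDiff ℝ r g → ∀ n p : ℕ, n + 2 ≤ r → p ≤ P →
    ∀ A : ℝ, (∀ x ∈ Icc (0 : ℝ) 1, |iteratedDeriv (n + 2) g x| ≤ A / bw m x ^ p) →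
    ∀ x ∈ Icc (0 : ℝ) 1, |iteratedDeriv n (fun y => g y - Bop m g y) x| ≤
      C / m * (n * |iteratedDeriv n g x| + n * |iteratedDeriv (n + 1) g x|
        + A * (bw m x / bw m x ^ p)) := by
  set CR : ℝ := 2 * (6 * (2 * r + 1) ^ 2) ^ (P + 1) *
    ((2 * (P + 1)).factorial * Real.exp 1 * (2 * Real.exp 1)) with hCR
  have hCR0 : 0 ≤ CR := by positivity
  refine ⟨r + 2 + CR, by positivity, ?_⟩
  intro m hm hrm g hg n p hn hp A hA x hx
  have hm' : (0 : ℝ) < m := by positivity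
  have hX := bw_pos hm hx
  have hA0 : 0 ≤ A := by
    have := (abs_nonneg _).trans (hA x hx)
    rw [le_div_iff₀ (by positivity)] at this
    linarith
  have hgn : ContDiff ℝ n g := hg.of_le (by exact_mod_cast (by omega : n ≤ r))
  obtain ⟨ξ, hξ, hD⟩ := exists_iteratedDeriv_Bop_eq hm (by omega : n ≤ m) hgn
  set M := m - n with hMdef
  have hMn : (M : ℝ) = m - n := by rw [hMdef, Nat.cast_sub (by omega)]
  set h := iteratedDeriv n g with hh
  set h1 := iteratedDeriv (n + 1) g x with hh1
  set q : ℝ := (m.descFactorial n : ℝ) / m ^ n with hq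
  have hq0 : 0 ≤ q := by positivity
  have hq1 : q ≤ 1 := by
    rw [hq, div_le_one (by positivity)]; exact_mod_cast Nat.descFactorial_le_pow m n
  have hq2 := one_sub_descFactorial_div_le hm n (by omega)
  rw [← hq] at hq2
  have hsum1 := sum_bern M x
  have hsumk := sum_bern_mul_id M x
  have hb0 : ∀ k, 0 ≤ bern M k x := fun k => bern_nonneg M k hx
  have hξ01 : ∀ k ≤ M, ξ k ∈ Icc (0 : ℝ) 1 := fun k hk => by
    refine ⟨le_trans (by positivity) (hξ k hk).1, (hξ k hk).2.trans ?_⟩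
    rw [div_le_one hm']
    have : (k : ℝ) ≤ M := by exact_mod_cast hk
    linarith
  have hdist : ∀ k ≤ M, |ξ k - x| ≤ |(k : ℝ) - M * x| / m + 2 * n / m := fun k hk => by
    have e : ξ k - x = (ξ k - k / m) + (k - M * x) / m + -(n * x / m) := by
      rw [hMn]; field_simp; ring
    have e1 : |ξ k - k / m| ≤ n / m := by
      rw [abs_of_nonneg (by linarith [(hξ k hk).1])]
      have := (hξ k hk).2; rw [add_div] at this; linarith
    have e2 : |-(n * x / m)| ≤ n / m := by
      rw [abs_neg, abs_of_nonneg (div_nonneg (mul_nonneg (by positivity) hx.1) hm'.le)]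
      gcongr
      have : (0 : ℝ) ≤ n := by positivity
      nlinarith [hx.2]
    rw [e]
    refine (abs_add_three _ _ _).trans ?_
    rw [abs_div, abs_of_pos hm']
    have : (2 * n / m : ℝ) = n / m + n / m := by ring
    linarith
  have hmean : |∑ k ∈ Finset.range (M + 1), bern M k x * (ξ k - x)| ≤ 2 * n / m := by
    have e : ∑ k ∈ Finset.range (M + 1), bern M k x * (ξ k - x)
        = ∑ k ∈ Finset.range (M + 1), bern M k x * (ξ k - k / m) - n * x / m := by
      have : ∀ k, bern M k x * (ξ k - x)
          = bern M k x * (ξ k - k / m) + ((bern M k x * k) / m - bern M k x * x) := fun k => by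
        ring
      simp_rw [this, Finset.sum_add_distrib, Finset.sum_sub_distrib, ← Finset.sum_div,
        ← Finset.sum_mul, hsumk, hsum1, hMn]
      have : (m - n) * x / m - 1 * x = -(n * x / m) := by field_simp; ring
      rw [this, sub_eq_add_neg]
    have l1 : 0 ≤ ∑ k ∈ Finset.range (M + 1), bern M k x * (ξ k - k / m) :=
      Finset.sum_nonneg fun k hk => mul_nonneg (hb0 k) (by
        have := (hξ k (by simpa [Nat.lt_succ_iff] using hk)).1; linarith)
    have l2 : ∑ k ∈ Finset.range (M + 1), bern M k x * (ξ k - k / m) ≤ n / m := by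
      calc _ ≤ ∑ k ∈ Finset.range (M + 1), bern M k x * (n / m) :=
            Finset.sum_le_sum fun k hk => mul_le_mul_of_nonneg_left (by
              have := (hξ k (by simpa [Nat.lt_succ_iff] using hk)).2
              rw [add_div] at this; linarith) (hb0 k)
        _ = _ := by rw [← Finset.sum_mul, hsum1, one_mul]
    have l3 : 0 ≤ n * x / m := div_nonneg (mul_nonneg (by positivity) hx.1) hm'.le
    have l4 : n * x / m ≤ n / m := by
      gcongr
      have : (0 : ℝ) ≤ n := by positivity
      nlinarith [hx.2]
    have l5 : (2 * n / m : ℝ) = n / m + n / m := by ring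
    rw [e, abs_le]; constructor <;> linarith
  have hrem : ∀ k ≤ M, |h (ξ k) - h x - h1 * (ξ k - x)| ≤
      A / m * (bw m x / bw m x ^ p) * (2 * (6 * (2 * r + 1) ^ 2) ^ (P + 1) *
        (1 + |(k : ℝ) - M * x| / √(m * bw m x)) ^ (2 * (P + 1))) := fun k hk => by
    have hY := bw_pos hm (hξ01 k hk)
    set b : ℝ := m * (ξ k - x) ^ 2 / bw m x with hb
    set a : ℝ := |(k : ℝ) - M * x| / √(m * bw m x) with ha
    have hbnn : 0 ≤ b := by positivity
    have hann : 0 ≤ a := by positivity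
    have hmb : 1 ≤ m * bw m x := by
      have := bw_ge (m := m) hx
      rw [div_le_iff₀ hm'] at this; linarith
    have hba : b ≤ (a + 2 * n) ^ 2 := by
      have hs1 : 1 ≤ √(m * bw m x) := Real.one_le_sqrt.2 hmb
      have hs2 : √(m * bw m x) ^ 2 = m * bw m x := Real.sq_sqrt (by positivity)
      have e1 : b = (m * |ξ k - x| / √(m * bw m x)) ^ 2 := by
        rw [div_pow, hs2, mul_pow, sq_abs, hb]; field_simp
      have e2 : m * |ξ k - x| ≤ |(k : ℝ) - M * x| + 2 * n := by
        have := mul_le_mul_of_nonneg_left (hdist k hk) hm'.le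
        rw [mul_add, mul_div_cancel₀ _ hm'.ne', mul_div_cancel₀ _ hm'.ne'] at this
        exact this
      have e3 : m * |ξ k - x| / √(m * bw m x) ≤ a + 2 * n := by
        rw [div_le_iff₀ (by positivity), add_mul, ha, div_mul_cancel₀ _ (by positivity)]
        have : (0 : ℝ) ≤ 2 * n := by positivity
        nlinarith
      rw [e1]; gcongr
    have hS : ∀ z ∈ uIcc x (ξ k), |iteratedDeriv (n + 2) g z|
        ≤ A / bw m x ^ p * (1 + (2 + 4 * b) ^ p) := fun z hz => by
      have hz01 : z ∈ Icc (0 : ℝ) 1 := uIcc_subset_Icc hx (hξ01 k hk) hz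
      have hZ := bw_pos hm hz01
      have key : bw m x ≤ (2 + 4 * b) * bw m z ∨ bw m x ≤ bw m z := by
        rcases min_le_iff.1 (min_bw_le m hz) with h' | h'
        · exact Or.inr h'
        · exact Or.inl ((bw_le_mul hm hx (hξ01 k hk)).trans (by gcongr))
      refine (hA z hz01).trans ?_
      have hpow : bw m x ^ p ≤ (1 + (2 + 4 * b) ^ p) * bw m z ^ p := by
        rcases key with h' | h'
        · calc _ ≤ ((2 + 4 * b) * bw m z) ^ p := by gcongr
            _ = (2 + 4 * b) ^ p * bw m z ^ p := mul_pow _ _ _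
            _ ≤ _ := by gcongr; linarith
        · calc _ ≤ 1 * bw m z ^ p := by rw [one_mul]; gcongr
            _ ≤ _ := by
              gcongr
              have : 0 ≤ (2 + 4 * b) ^ p := by positivity
              linarith
      rw [div_mul_eq_mul_div, div_le_div_iff₀ (by positivity) (by positivity), mul_assoc]
      gcongr
    have hT := abs_taylor_two_le (h := h) (h' := iteratedDeriv (n + 1) g)
      (fun z => hasDerivAt_iteratedDeriv hg (show n < r by omega) z)
      (fun z => hasDerivAt_iteratedDeriv hg (show n + 1 < r by omega) z) hS
    have hsq : (ξ k - x) ^ 2 = b * (bw m x / m) := by rw [hb]; field_simp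
    calc _ ≤ _ := hT
      _ = A / m * (bw m x / bw m x ^ p) * (b * (1 + (2 + 4 * b) ^ p)) := by
          rw [hsq]; ring
      _ ≤ _ := by
          exact mul_le_mul_of_nonneg_left
            (remainder_poly_bound hbnn hann hba (by omega : n ≤ r) hp) (by positivity)
  have hremsum : |∑ k ∈ Finset.range (M + 1), bern M k x * (h (ξ k) - h x - h1 * (ξ k - x))|
      ≤ A / m * (bw m x / bw m x ^ p) * CR := by
    calc _ ≤ ∑ k ∈ Finset.range (M + 1), bern M k x * (A / m * (bw m x / bw m x ^ p) *
          (2 * (6 * (2 * r + 1) ^ 2) ^ (P + 1) *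
            (1 + |(k : ℝ) - M * x| / √(m * bw m x)) ^ (2 * (P + 1)))) := by
          refine (Finset.abs_sum_le_sum_abs _ _).trans (Finset.sum_le_sum fun k hk => ?_)
          rw [abs_mul, abs_of_nonneg (hb0 k)]
          exact mul_le_mul_of_nonneg_left (hrem k (by simpa [Nat.lt_succ_iff] using hk)) (hb0 k)
      _ = A / m * (bw m x / bw m x ^ p) * (2 * (6 * (2 * r + 1) ^ 2) ^ (P + 1)) *
          ∑ k ∈ Finset.range (M + 1), bern M k x *
            (1 + |(k : ℝ) - M * x| / √(m * bw m x)) ^ (2 * (P + 1)) := by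
          rw [Finset.mul_sum]
          exact Finset.sum_congr rfl fun k _ => by ring
      _ ≤ A / m * (bw m x / bw m x ^ p) * (2 * (6 * (2 * r + 1) ^ 2) ^ (P + 1)) *
          ((2 * (P + 1)).factorial * Real.exp 1 * (2 * Real.exp 1)) := by
          gcongr
          exact sum_bern_mul_pow_le _ hm (by omega) hx
      _ = _ := by rw [hCR]; ring
  have hdec : iteratedDeriv n (fun y => g y - Bop m g y) x = (1 - q) * h x
      - q * (h1 * ∑ k ∈ Finset.range (M + 1), bern M k x * (ξ k - x))
      - q * ∑ k ∈ Finset.range (M + 1), bern M k x * (h (ξ k) - h x - h1 * (ξ k - x)) := by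
    rw [iteratedDeriv_fun_sub hgn.contDiffAt (contDiff_Bop m g).contDiffAt, hD x]
    have e : ∑ k ∈ Finset.range (M + 1), bern M k x * (h (ξ k) - h x - h1 * (ξ k - x))
        = ∑ k ∈ Finset.range (M + 1), bern M k x * h (ξ k) - h x
          - h1 * ∑ k ∈ Finset.range (M + 1), bern M k x * (ξ k - x) := by
      have : ∀ k, bern M k x * (h (ξ k) - h x - h1 * (ξ k - x))
          = bern M k x * h (ξ k) - bern M k x * h x - h1 * (bern M k x * (ξ k - x)) := fun k => by
        ring
      simp_rw [this, Finset.sum_sub_distrib, ← Finset.sum_mul, ← Finset.mul_sum, hsum1, one_mul]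
    rw [e]; ring
  have t1 : |(1 - q) * h x| ≤ r / m * (n * |h x|) := by
    rw [abs_mul, abs_of_nonneg (by linarith)]
    have : (n : ℝ) ≤ r := by exact_mod_cast (by omega : n ≤ r)
    calc _ ≤ (n * n / m) * |h x| := by gcongr
      _ ≤ (r * n / m) * |h x| := by gcongr
      _ = _ := by ring
  have t2 : |q * (h1 * ∑ k ∈ Finset.range (M + 1), bern M k x * (ξ k - x))|
      ≤ 2 / m * (n * |h1|) := by
    rw [abs_mul, abs_mul, abs_of_nonneg hq0]
    calc _ ≤ 1 * (|h1| * (2 * n / m)) := by gcongr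
      _ = _ := by ring
  have t3 : |q * ∑ k ∈ Finset.range (M + 1), bern M k x * (h (ξ k) - h x - h1 * (ξ k - x))|
      ≤ CR / m * (A * (bw m x / bw m x ^ p)) := by
    rw [abs_mul, abs_of_nonneg hq0]
    calc _ ≤ 1 * (A / m * (bw m x / bw m x ^ p) * CR) := by gcongr
      _ = _ := by ring
  rw [hdec]
  refine (abs_sub _ _).trans ((add_le_add (abs_sub _ _) le_rfl).trans ?_)
  have n1 : 0 ≤ 1 / (m : ℝ) * (n * |h x|) := by positivity
  have n2 : 0 ≤ 1 / (m : ℝ) * (n * |h1|) := by positivity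
  have n3 : 0 ≤ 1 / (m : ℝ) * (A * (bw m x / bw m x ^ p)) := by positivity
  have hr0 : (0 : ℝ) ≤ r := by positivity
  calc _ ≤ r / m * (n * |h x|) + 2 / m * (n * |h1|) + CR / m * (A * (bw m x / bw m x ^ p)) := by
        linarith
    _ = r * (1 / m * (n * |h x|)) + 2 * (1 / m * (n * |h1|))
        + CR * (1 / m * (A * (bw m x / bw m x ^ p))) := by ring
    _ ≤ (r + 2 + CR) * (1 / m * (n * |h x|)) + (r + 2 + CR) * (1 / m * (n * |h1|))
        + (r + 2 + CR) * (1 / m * (A * (bw m x / bw m x ^ p))) := by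
        gcongr <;> linarith
    _ = _ := by ring

end BernsteinSmoothMain

section WeightedDerivatives

theorem bw_one_sub (m : ℕ) (x : ℝ) : bw m (1 - x) = bw m x := by
  unfold bw; rw [sub_sub_cancel, min_comm]

theorem bw_eq_of_le_half (m : ℕ) {x : ℝ} (hx : x ≤ 1 / 2) : bw m x = x + 1 / m := by
  unfold bw; rw [min_eq_left (by linarith)]

theorem abs_sub_le_of_abs_deriv_le_neg_deriv {u u' v v' : ℝ → ℝ} {a b : ℝ} (hab : a ≤ b)
    (hu : ∀ x ∈ Icc a b, HasDerivAt u (u' x) x) (hv : ∀ x ∈ Icc a b, HasDerivAt v (v' x) x)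
    (h : ∀ x ∈ Icc a b, |u' x| ≤ -v' x) : |u a - u b| ≤ v a - v b := by
  have key : ∀ s : ℝ, |s| = 1 → s * u a - s * u b ≤ v a - v b := by
    intro s hs
    have hd : ∀ x ∈ Icc a b, HasDerivAt (fun y => v y - s * u y) (v' x - s * u' x) x :=
      fun x hx => (hv x hx).sub ((hu x hx).const_mul s)
    have hanti : AntitoneOn (fun y => v y - s * u y) (Icc a b) := by
      refine antitoneOn_of_hasDerivWithinAt_nonpos (f' := fun x => v' x - s * u' x)
        (convex_Icc a b)
        (fun x hx => (hd x hx).continuousAt.continuousWithinAt)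
        (fun x hx => (hd x (interior_subset hx)).hasDerivWithinAt) fun x hx => ?_
      have h1 := h x (interior_subset hx)
      have h2 : -(s * u' x) ≤ |u' x| := by
        refine (neg_le_abs _).trans ?_
        rw [abs_mul, hs, one_mul]
      linarith
    have := hanti (left_mem_Icc.2 hab) (right_mem_Icc.2 hab) hab
    simp only at this
    linarith
  rw [abs_le]
  have h1 := key 1 (by simp)
  have h2 := key (-1) (by simp)
  constructor <;> linarith

theorem abs_le_of_abs_deriv_le_div_bw_pow_left {m : ℕ} (hm : 1 ≤ m) {u u' : ℝ → ℝ} {A B : ℝ}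
    (hA : 0 ≤ A) (hu : ∀ x, HasDerivAt u (u' x) x) {p q : ℕ} (hpq : q = p ∨ q = p + 1 ∧ 1 ≤ p)
    (hu' : ∀ x ∈ Icc (0 : ℝ) 1, |u' x| ≤ A / bw m x ^ q) (hB : |u (1 / 2)| ≤ B)
    {x : ℝ} (hx0 : 0 ≤ x) (hx : x ≤ 1 / 2) : |u x| ≤ B + A / bw m x ^ p := by
  have hm' : (0 : ℝ) < 1 / m := by positivity
  have hmem : ∀ z ∈ Icc x (1 / 2), z ∈ Icc (0 : ℝ) 1 :=
    fun z hz => ⟨hx0.trans hz.1, hz.2.trans (by norm_num)⟩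
  have hX := bw_pos hm (hmem x ⟨le_rfl, hx⟩)
  have key : |u x - u (1 / 2)| ≤ A / bw m x ^ p := by
    rcases hpq with rfl | ⟨rfl, hp⟩
    · have h1 : ∀ z ∈ Icc x (1 / 2), |u' z| ≤ A / bw m x ^ q := fun z hz => by
        refine (hu' z (hmem z hz)).trans ?_
        gcongr
        rw [bw_eq_of_le_half m hx, bw_eq_of_le_half m hz.2]; linarith [hz.1]
      refine (abs_sub_le_of_abs_deriv_le (fun z _ => hu z) h1 (right_mem_Icc.2 hx)
        (left_mem_Icc.2 hx)).trans ?_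
      have : |x - 1 / 2| ≤ 1 := by rw [abs_le]; constructor <;> linarith
      exact mul_le_of_le_one_right (by positivity) this
    · have hp' : (1 : ℝ) ≤ p := by exact_mod_cast hp
      set v : ℝ → ℝ := fun z => A / p * ((z + 1 / m) ^ p)⁻¹ with hv
      set v' : ℝ → ℝ := fun z => A / p * (-(p * (z + 1 / m) ^ (p - 1)) / ((z + 1 / m) ^ p) ^ 2)
        with hv'
      have hpos : ∀ z ∈ Icc x (1 / 2), 0 < z + 1 / (m : ℝ) := fun z hz => by
        have := (hmem z hz).1; linarith
      have hvd : ∀ z ∈ Icc x (1 / 2), HasDerivAt v (v' z) z := fun z hz => by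
        have h1 : HasDerivAt (fun z : ℝ => (z + 1 / (m : ℝ)) ^ p)
            (p * (z + 1 / m) ^ (p - 1)) z := by
          simpa using! ((hasDerivAt_id z).add_const (1 / (m : ℝ))).pow p
        exact (h1.inv (pow_pos (hpos z hz) p).ne').const_mul _
      have := abs_sub_le_of_abs_deriv_le_neg_deriv hx (fun z _ => hu z) hvd fun z hz => by
        refine (hu' z (hmem z hz)).trans (le_of_eq ?_)
        rw [hv', bw_eq_of_le_half m hz.2]
        have h3 := (hpos z hz).ne'
        obtain ⟨p, rfl⟩ : ∃ P, p = P + 1 := ⟨p - 1, by omega⟩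
        have h4 : ((p + 1 : ℕ) : ℝ) ≠ 0 := by positivity
        simp only [Nat.add_sub_cancel]
        generalize z + 1 / (m : ℝ) = y at h3
        field_simp
        ring
      refine this.trans ?_
      have h0 : 0 ≤ v (1 / 2) := by
        have := hpos (1 / 2) (right_mem_Icc.2 hx)
        positivity
      have h1 : v x ≤ A / bw m x ^ p := by
        rw [hv, bw_eq_of_le_half m hx, div_eq_mul_inv A (_ ^ p)]
        simp only
        have := hpos x (left_mem_Icc.2 hx)
        gcongr
        exact div_le_self hA hp'
      linarith
  have := abs_sub_abs_le_abs_sub (u x) (u (1 / 2))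
  linarith

theorem abs_le_of_abs_deriv_le_div_bw_pow {m : ℕ} (hm : 1 ≤ m) {u u' : ℝ → ℝ} {A B : ℝ}
    (hA : 0 ≤ A) (hu : ∀ x, HasDerivAt u (u' x) x) {p q : ℕ} (hpq : q = p ∨ q = p + 1 ∧ 1 ≤ p)
    (hu' : ∀ x ∈ Icc (0 : ℝ) 1, |u' x| ≤ A / bw m x ^ q) (hB : |u (1 / 2)| ≤ B)
    {x : ℝ} (hx : x ∈ Icc (0 : ℝ) 1) : |u x| ≤ B + A / bw m x ^ p := by
  rcases le_total x (1 / 2) with h | h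
  · exact abs_le_of_abs_deriv_le_div_bw_pow_left hm hA hu hpq hu' hB hx.1 h
  · have := abs_le_of_abs_deriv_le_div_bw_pow_left hm (u := fun z => u (1 - z))
      (u' := fun z => -u' (1 - z)) hA (fun z => by simpa using! (hu (1 - z)).comp_const_sub 1 z)
      hpq (fun z hz => by
        rw [abs_neg, ← bw_one_sub]
        exact hu' _ ⟨by linarith [hz.2], by linarith [hz.1]⟩) (B := B)
      (by norm_num at hB ⊢; exact hB) (x := 1 - x) (by linarith [hx.2]) (by linarith)
    simpa [bw_one_sub] using this

/-- Control of the weighted intermediate derivatives by the weighted top derivative. -/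
theorem abs_iteratedDeriv_le_div_bw_pow {l m : ℕ} (hl : 1 ≤ l) (hm : 1 ≤ m) {g : ℝ → ℝ}
    (hg : ContDiff ℝ (2 * l : ℕ) g) {K : ℝ} (hK : 0 ≤ K)
    (htop : ∀ x ∈ Icc (0 : ℝ) 1, |iteratedDeriv (2 * l) g x| ≤ K / bw m x ^ l)
    (hmid : ∀ n ≤ 2 * l, |iteratedDeriv n g (1 / 2)| ≤ K) :
    ∀ n, 2 ≤ n → n ≤ 2 * l → ∀ x ∈ Icc (0 : ℝ) 1,
      |iteratedDeriv n g x| ≤ (2 * l + 1) * 2 ^ l * K / bw m x ^ max 1 (n - l) := by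
  have key : ∀ i, i + 2 ≤ 2 * l → ∀ x ∈ Icc (0 : ℝ) 1,
      |iteratedDeriv (2 * l - i) g x|
        ≤ (i + 1) * 2 ^ l * K / bw m x ^ max 1 (2 * l - i - l) := by
    intro i
    induction i with
    | zero =>
      intro _ x hx
      have hX := bw_pos hm hx
      refine (htop x hx).trans ?_
      rw [show max 1 (2 * l - 0 - l) = l by omega]
      gcongr
      have : (1 : ℝ) ≤ 2 ^ l := one_le_pow₀ (by norm_num)
      simp only [CharP.cast_eq_zero, zero_add, one_mul]
      nlinarith
    | succ i ih =>
      intro hi x hx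
      have hX := bw_pos hm hx
      obtain ⟨n, hn⟩ : ∃ n, 2 * l = n + 1 + i := ⟨2 * l - i - 1, by omega⟩
      have e1 : 2 * l - (i + 1) = n := by omega
      have e2 : 2 * l - i = n + 1 := by omega
      rw [e1]
      rw [e2] at ih
      have hpl : max 1 (n - l) ≤ l := by omega
      refine (abs_le_of_abs_deriv_le_div_bw_pow hm (by positivity)
        (fun z => hasDerivAt_iteratedDeriv hg (show n < 2 * l by omega) z)
        (p := max 1 (n - l)) (q := max 1 (n + 1 - l)) (by omega) (ih (by omega))
        (hmid n (by omega)) hx).trans ?_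
      have hw : bw m x ^ max 1 (n - l) ≤ 2 ^ l :=
        (pow_le_pow_left₀ hX.le (bw_le_two hm hx) _).trans
          (pow_le_pow_right₀ (by norm_num) hpl)
      have : K ≤ 2 ^ l * K / bw m x ^ max 1 (n - l) := by
        rw [le_div_iff₀ (by positivity), mul_comm]; gcongr
      calc _ ≤ 2 ^ l * K / bw m x ^ max 1 (n - l)
            + (i + 1) * 2 ^ l * K / bw m x ^ max 1 (n - l) := by gcongr
        _ = _ := by push_cast; ring
  intro n hn2 hnl x hx
  have hX := bw_pos hm hx
  have := key (2 * l - n) (by omega) x hx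
  rw [show 2 * l - (2 * l - n) = n by omega] at this
  refine this.trans ?_
  gcongr
  rw [Nat.cast_sub hnl]
  push_cast
  have : (0 : ℝ) ≤ n := by positivity
  linarith

/-- Iterating `I - B_m` on a function with weighted derivative bounds. -/
theorem exists_abs_iterate_sub_Bop_le (l : ℕ) : ∃ C : ℝ, 0 ≤ C ∧ ∀ m : ℕ, 1 ≤ m → 2 * l ≤ m →
    ∀ j, 1 ≤ j → j ≤ l → ∀ g : ℝ → ℝ, ContDiff ℝ (2 * l : ℕ) g → ∀ K : ℝ, 0 ≤ K →
    (∀ n, 2 ≤ n → n ≤ 2 * j → ∀ x ∈ Icc (0 : ℝ) 1,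
      |iteratedDeriv n g x| ≤ K / bw m x ^ max 1 (n - j)) →
    ∀ x ∈ Icc (0 : ℝ) 1, |((fun g => g - Bop m g)^[j] g) x| ≤ (C / m) ^ j * K := by
  obtain ⟨C, hC, H⟩ := abs_iteratedDeriv_sub_Bop_le (2 * l) (2 * l)
  refine ⟨C * (6 * l + 2), by positivity, ?_⟩
  intro m hm hlm j hj
  induction j, hj using Nat.le_induction with
  | base =>
    intro h1 g hg K hK hgb x hx
    have hX := bw_pos hm hx
    have := H m hm hlm g hg 0 1 (by omega) (by omega) K
      (fun z hz => by simpa using hgb 2 (by omega) (by omega) z hz) x hx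
    simp only [iteratedDeriv_zero, CharP.cast_eq_zero, zero_mul, add_zero, zero_add, pow_one,
      div_self hX.ne', mul_one] at this
    simp only [Function.iterate_one, Pi.sub_apply, pow_one]
    refine this.trans ?_
    gcongr
    have : (0 : ℝ) ≤ C * (6 * l + 1) := by positivity
    linarith
  | succ j hj ih =>
    intro h1 g hg K hK hgb x hx
    rw [Function.iterate_succ_apply]
    have hg' : ContDiff ℝ (2 * l : ℕ) (g - Bop m g) := hg.sub (contDiff_Bop m g)
    refine (ih (by omega) _ hg' (C * (6 * l + 2) / m * K) (by positivity) ?_ x hx).trans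
      (le_of_eq (by ring))
    intro n hn2 hnj x hx
    have hX := bw_pos hm hx
    have hX2 := bw_le_two hm hx
    have h0 := H m hm hlm g hg n (max 1 (n + 2 - (j + 1))) (by omega) (by omega) K
      (hgb (n + 2) (by omega) (by omega)) x hx
    refine h0.trans ?_
    set e := max 1 (n - j) with he
    have t1 : |iteratedDeriv n g x| ≤ 2 * (K / bw m x ^ e) := by
      refine (hgb n hn2 (by omega) x hx).trans ?_
      have : bw m x ^ e ≤ 2 * bw m x ^ max 1 (n - (j + 1)) := by
        rcases (show e = max 1 (n - (j + 1)) ∨ e = max 1 (n - (j + 1)) + 1 by omega) with h | h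
        · rw [h]; linarith [pow_pos hX (max 1 (n - (j + 1)))]
        · rw [h, pow_succ, mul_comm]; gcongr
      rw [← mul_div_assoc, div_le_div_iff₀ (by positivity) (by positivity)]
      calc _ ≤ K * (2 * bw m x ^ max 1 (n - (j + 1))) := by gcongr
        _ = _ := by ring
    have t2 : |iteratedDeriv (n + 1) g x| ≤ K / bw m x ^ e := by
      have := hgb (n + 1) (by omega) (by omega) x hx
      rwa [show n + 1 - (j + 1) = n - j by omega] at this
    have t3 : K * (bw m x / bw m x ^ max 1 (n + 2 - (j + 1))) ≤ 2 * (K / bw m x ^ e) := by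
      rw [← mul_div_assoc, ← mul_div_assoc, div_le_div_iff₀ (by positivity) (by positivity)]
      rcases (show max 1 (n + 2 - (j + 1)) = e + 1 ∨ max 1 (n + 2 - (j + 1)) = e by omega)
        with h | h
      · rw [h, pow_succ]
        have : 0 ≤ K * bw m x * bw m x ^ e := by positivity
        linarith
      · rw [h]
        calc _ ≤ K * 2 * bw m x ^ e := by gcongr
          _ = _ := by ring
    have hn' : (n : ℝ) ≤ 2 * l := by exact_mod_cast (by omega : n ≤ 2 * l)
    have hKe : 0 ≤ K / bw m x ^ e := by positivity
    calc _ ≤ C / m * (2 * l * (2 * (K / bw m x ^ e)) + 2 * l * (K / bw m x ^ e)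
          + 2 * (K / bw m x ^ e)) := by gcongr
      _ = _ := by ring

end WeightedDerivatives

section ProductEstimate

theorem bw_le_three_mul {m : ℕ} {x z : ℝ} (h1 : z ∈ Icc x (x + 1 / 3)) (hx0 : 0 ≤ x)
    (hx : x ≤ 1 / 2) : bw m x ≤ 3 * bw m z := by
  have hm : (0 : ℝ) ≤ 1 / m := by positivity
  rw [bw_eq_of_le_half m hx]
  unfold bw
  have : x / 3 ≤ min z (1 - z) := le_min (by linarith [h1.1]) (by linarith [h1.2])
  linarith

theorem sqrt_bw_le {m : ℕ} (hm : 1 ≤ m) (x : ℝ) : √(bw m x) ≤ 4 / 3 := by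
  rw [Real.sqrt_le_left (by norm_num)]
  have h1 : min x (1 - x) ≤ 1 / 2 := by
    rcases le_total x (1 / 2) with h | h
    · exact (min_le_left _ _).trans h
    · exact (min_le_right _ _).trans (by linarith)
  have h2 : 1 / (m : ℝ) ≤ 1 := by
    rw [div_le_one (by positivity)]; exact_mod_cast hm
  unfold bw; linarith

/-- Weighted bounds for all derivatives from a bound on the function and the top derivative. -/
theorem exists_abs_iteratedDeriv_le_div_sqrt_bw_pow (l : ℕ) : ∃ C : ℝ, 1 ≤ C ∧
    ∀ m : ℕ, 1 ≤ m → ∀ F : ℝ → ℝ, ContDiff ℝ (2 * l : ℕ) F → ∀ M τ : ℝ, 0 ≤ M → 0 < τ → τ ≤ 1 →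
    (∀ x ∈ Icc (0 : ℝ) 1, |F x| ≤ M) →
    (∀ x ∈ Icc (0 : ℝ) 1, |iteratedDeriv (2 * l) F x| ≤ M / (τ ^ (2 * l) * bw m x ^ l)) →
    ∀ i ≤ 2 * l, ∀ x ∈ Icc (0 : ℝ) 1, |iteratedDeriv i F x| ≤ C * M / (τ * √(bw m x)) ^ i := by
  obtain ⟨C, hC, H⟩ := exists_intermediate_deriv_bound (2 * l)
  refine ⟨C * 4 ^ (2 * l), one_le_mul_of_one_le_of_one_le hC (one_le_pow₀ (by norm_num)), ?_⟩
  intro m hm F hF M τ hM hτ hτ1 h0 htop i hi x hx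
  have hX := bw_pos hm hx
  set L := τ * √(bw m x) / 4 with hL
  have hLpos : 0 < L := by positivity
  have hL3 : L ≤ 1 / 3 := by
    have : τ * √(bw m x) ≤ 1 * (4 / 3) := by gcongr; exact sqrt_bw_le hm x
    rw [hL]; linarith
  have hLpow : L ^ (2 * l) = τ ^ (2 * l) * bw m x ^ l / 16 ^ l := by
    rw [hL, div_pow, mul_pow, pow_mul √(bw m x) 2 l, Real.sq_sqrt hX.le, pow_mul 4 2 l]
    norm_num
  obtain ⟨a, hxa, ha⟩ : ∃ a, x ∈ Icc a (a + L) ∧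
      ∀ z ∈ Icc a (a + L), z ∈ Icc (0 : ℝ) 1 ∧ bw m x ≤ 3 * bw m z := by
    rcases le_total x (1 / 2) with h | h
    · refine ⟨x, ⟨le_rfl, by linarith⟩, fun z hz => ⟨⟨hx.1.trans hz.1, by linarith [hz.2]⟩, ?_⟩⟩
      exact bw_le_three_mul ⟨hz.1, by linarith [hz.2]⟩ hx.1 h
    · refine ⟨x - L, ⟨by linarith, by linarith⟩,
        fun z hz => ⟨⟨by linarith [hz.1], by linarith [hz.2, hx.2]⟩, ?_⟩⟩
      rw [← bw_one_sub m x, ← bw_one_sub m z]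
      exact bw_le_three_mul ⟨by linarith [hz.2], by linarith [hz.1]⟩ (by linarith [hx.2])
        (by linarith)
  refine (H F hF a L M hLpos hM (fun z hz => h0 z (ha z hz).1) (fun z hz => ?_) i hi x hxa).trans
    ?_
  · have hZ := bw_pos hm (ha z hz).1
    refine (htop z (ha z hz).1).trans ?_
    gcongr
    rw [hLpow, mul_div_assoc]
    gcongr
    rw [div_le_iff₀ (by positivity), ← mul_pow]
    gcongr
    linarith [(ha z hz).2]
  · rw [hL, div_pow, div_div_eq_mul_div]
    gcongr ?_ / _
    rw [mul_right_comm C]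
    gcongr
    norm_num

/-- Boundedness of `(I - B_m)^ℓ` on products of functions with weighted derivative bounds. -/
theorem exists_abs_iterate_sub_Bop_mul_le (l : ℕ) (hl : 1 ≤ l) : ∃ C : ℝ, 0 ≤ C ∧
    ∀ m : ℕ, 1 ≤ m → 2 * l ≤ m → ∀ F H : ℝ → ℝ, ContDiff ℝ (2 * l : ℕ) F →
    ContDiff ℝ (2 * l : ℕ) H → ∀ M N Λ : ℝ, 0 ≤ M → 0 ≤ N → 1 ≤ Λ →
    (∀ x ∈ Icc (0 : ℝ) 1, |F x| ≤ M) → (∀ x ∈ Icc (0 : ℝ) 1, |H x| ≤ N) →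
    (∀ x ∈ Icc (0 : ℝ) 1, |iteratedDeriv (2 * l) F x| ≤ M * Λ / bw m x ^ l) →
    (∀ x ∈ Icc (0 : ℝ) 1, |iteratedDeriv (2 * l) H x| ≤ N * Λ / bw m x ^ l) →
    ∀ x ∈ Icc (0 : ℝ) 1, |((fun g => g - Bop m g)^[l] fun y => F y * H y) x|
      ≤ C * (M * N) * (Λ / m ^ l) := by
  obtain ⟨C, hC, I1⟩ := exists_abs_iteratedDeriv_le_div_sqrt_bw_pow l
  obtain ⟨C', hC', I2⟩ := exists_abs_iterate_sub_Bop_le l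
  set D : ℝ := 2 ^ (2 * l) * (C * C) * 2 ^ (2 * l) with hD
  refine ⟨C' ^ l * ((2 * l + 1) * 2 ^ l * D), by positivity, ?_⟩
  intro m hm hlm F H hF hH M N Λ hM hN hΛ hF0 hH0 hFt hHt
  have hΛ0 : 0 < Λ := by linarith
  set τ : ℝ := Λ ^ (-(1 / (2 * l : ℝ))) with hτ
  have hτ0 : 0 < τ := by positivity
  have hτ1 : τ ≤ 1 := Real.rpow_le_one_of_one_le_of_nonpos hΛ (by
    rw [neg_nonpos]; positivity)
  have hτp : τ ^ (2 * l) = Λ⁻¹ := by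
    rw [hτ, ← Real.rpow_natCast, ← Real.rpow_mul hΛ0.le, ← Real.rpow_neg_one]
    congr 1; push_cast; field_simp
  have conv : ∀ a w : ℝ, a / (τ ^ (2 * l) * w) = a * Λ / w := fun a w => by
    rw [hτp]; field_simp
  have bF := I1 m hm F hF M τ hM hτ0 hτ1 hF0 (fun x hx => by rw [conv]; exact hFt x hx)
  have bH := I1 m hm H hH N τ hN hτ0 hτ1 hH0 (fun x hx => by rw [conv]; exact hHt x hx)
  have hG : ContDiff ℝ (2 * l : ℕ) (fun y => F y * H y) := hF.mul hH
  have bG : ∀ i ≤ 2 * l, ∀ x ∈ Icc (0 : ℝ) 1, |iteratedDeriv i (fun y => F y * H y) x|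
      ≤ 2 ^ (2 * l) * (C * C) * (M * N) / (τ * √(bw m x)) ^ i := fun i hi x hx => by
    have hX := bw_pos hm hx
    refine (abs_iteratedDeriv_mul_le (κ := τ * √(bw m x)) (A := C * M) (B := C * N)
      (hF.of_le (by exact_mod_cast hi)) (hH.of_le (by exact_mod_cast hi))
      (by positivity) (fun j hj => bF j (by omega) x hx)
      (fun j hj => bH j (by omega) x hx)).trans ?_
    gcongr ?_ / _
    calc _ ≤ 2 ^ (2 * l) * (C * M * (C * N)) := by gcongr; norm_num
      _ = _ := by ring
  have hK : 0 ≤ D * (M * N) * Λ := by positivity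
  have htop : ∀ x ∈ Icc (0 : ℝ) 1, |iteratedDeriv (2 * l) (fun y => F y * H y) x|
      ≤ D * (M * N) * Λ / bw m x ^ l := fun x hx => by
    have hX := bw_pos hm hx
    refine (bG _ le_rfl x hx).trans ?_
    rw [mul_pow, conv, pow_mul √(bw m x) 2 l, Real.sq_sqrt hX.le, hD]
    gcongr ?_ * (M * N) * Λ / _
    have : (1 : ℝ) ≤ 2 ^ (2 * l) := one_le_pow₀ (by norm_num)
    exact le_mul_of_one_le_right (by positivity) this
  have hmid : ∀ n ≤ 2 * l, |iteratedDeriv n (fun y => F y * H y) (1 / 2)|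
      ≤ D * (M * N) * Λ := fun n hn => by
    refine (bG n hn _ ⟨by norm_num, by norm_num⟩).trans ?_
    have hw : 1 / 2 ≤ √(bw m (1 / 2)) := by
      refine Real.le_sqrt_of_sq_le ?_
      rw [bw_eq_of_le_half m le_rfl]
      have : (0 : ℝ) ≤ 1 / m := by positivity
      linarith
    have e1 : 1 / (2 ^ (2 * l) * Λ) ≤ (τ * √(bw m (1 / 2))) ^ n := by
      calc _ = (1 / 2) ^ (2 * l) * τ ^ (2 * l) := by
            rw [hτp, one_div, one_div, inv_pow, mul_inv]
        _ ≤ (1 / 2) ^ n * τ ^ n := by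
          gcongr ?_ * ?_
          · exact pow_le_pow_of_le_one (by norm_num) (by norm_num) hn
          · exact pow_le_pow_of_le_one hτ0.le hτ1 hn
        _ = (τ * (1 / 2)) ^ n := by rw [mul_pow, mul_comm]
        _ ≤ _ := by gcongr
    rw [div_le_iff₀ (by positivity)]
    calc _ = D * (M * N) * Λ * (1 / (2 ^ (2 * l) * Λ)) := by rw [hD]; field_simp
      _ ≤ _ := by gcongr
  intro x hx
  refine (I2 m hm hlm l hl le_rfl _ hG _ (by positivity)
    (abs_iteratedDeriv_le_div_bw_pow hl hm hG hK htop hmid) x hx).trans (le_of_eq ?_)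
  rw [div_pow]; ring

end ProductEstimate

section LinearStructure

/-- The Bernstein operator as a linear endomorphism. -/
noncomputable def BopLin (m : ℕ) : Module.End ℝ (ℝ → ℝ) where
  toFun := Bop m
  map_add' f g := by
    funext x; simp [Bop, mul_add, Finset.sum_add_distrib]
  map_smul' c f := by
    funext x; simp [Bop, Finset.mul_sum, mul_left_comm]

theorem iterate_sub_Bop_eq (m l : ℕ) :
    (fun g => g - Bop m g)^[l] = ⇑((1 - BopLin m) ^ l) := by
  rw [Module.End.coe_pow]
  rfl

theorem abs_Bop_le {m : ℕ} {g : ℝ → ℝ} {E : ℝ} (hm : 1 ≤ m)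
    (hg : ∀ x ∈ Icc (0 : ℝ) 1, |g x| ≤ E) {x : ℝ} (hx : x ∈ Icc (0 : ℝ) 1) : |Bop m g x| ≤ E := by
  have hm' : (0 : ℝ) < m := by positivity
  calc |Bop m g x| ≤ ∑ k ∈ Finset.range (m + 1), bern m k x * E := by
        refine (Finset.abs_sum_le_sum_abs _ _).trans (Finset.sum_le_sum fun k hk => ?_)
        rw [abs_mul, abs_of_nonneg (bern_nonneg m k hx)]
        refine mul_le_mul_of_nonneg_left (hg _ ⟨by positivity, ?_⟩) (bern_nonneg m k hx)
        rw [div_le_one hm']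
        exact_mod_cast Nat.lt_succ_iff.1 (Finset.mem_range.1 hk)
    _ = E := by rw [← Finset.sum_mul, sum_bern, one_mul]

theorem abs_iterate_sub_Bop_le {m : ℕ} (hm : 1 ≤ m) (l : ℕ) {g : ℝ → ℝ} {E : ℝ}
    (hg : ∀ x ∈ Icc (0 : ℝ) 1, |g x| ≤ E) :
    ∀ x ∈ Icc (0 : ℝ) 1, |((fun g => g - Bop m g)^[l] g) x| ≤ 2 ^ l * E := by
  induction l with
  | zero => simpa using hg
  | succ l ih =>
    intro x hx
    rw [Function.iterate_succ_apply', Pi.sub_apply]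
    refine (abs_sub _ _).trans ((add_le_add (ih x hx) (abs_Bop_le hm ih hx)).trans ?_)
    rw [pow_succ]; linarith

theorem exists_abs_iterate_sub_Bop_le_of_approx (l : ℕ) (hl : 1 ≤ l) (c : ℝ) (hc : 0 ≤ c) :
    ∃ C : ℝ, 0 ≤ C ∧ ∀ m : ℕ, 1 ≤ m → ∀ ρ : ℝ, 0 < ρ → ρ ≤ 1 → 1 ≤ m ^ l * ρ →
    ∀ f k F H : ℝ → ℝ, ContDiff ℝ (2 * l : ℕ) F → ContDiff ℝ (2 * l : ℕ) H →
    ∀ M N : ℝ, (∀ x ∈ Icc (0 : ℝ) 1, |f x| ≤ M) → (∀ x ∈ Icc (0 : ℝ) 1, |k x| ≤ N) →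
    (∀ x ∈ Icc (0 : ℝ) 1, |F x - f x| ≤ c * M * ρ) →
    (∀ x ∈ Icc (0 : ℝ) 1, |H x - k x| ≤ c * N * ρ) →
    (∀ x ∈ Icc (0 : ℝ) 1, |iteratedDeriv (2 * l) F x| ≤ c * M * (m ^ l * ρ) / bw m x ^ l) →
    (∀ x ∈ Icc (0 : ℝ) 1, |iteratedDeriv (2 * l) H x| ≤ c * N * (m ^ l * ρ) / bw m x ^ l) →
    ∀ x ∈ Icc (0 : ℝ) 1, |((fun g => g - Bop m g)^[l] fun y => k y * f y) x|
      ≤ C * (N * M) * ρ := by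
  obtain ⟨C, hC, I⟩ := exists_abs_iterate_sub_Bop_mul_le l hl
  refine ⟨C * (c + 1) ^ 2 + 2 ^ l * (c + c * (c + 1)) + 2 ^ l * (2 * l) ^ l, by positivity, ?_⟩
  intro m hm ρ hρ hρ1 hmρ f k F H hF hH M N hf hk hFf hHk hFt hHt x hx
  have hm' : (0 : ℝ) < m := by positivity
  have hM : 0 ≤ M := (abs_nonneg _).trans (hf x hx)
  have hN : 0 ≤ N := (abs_nonneg _).trans (hk x hx)
  have hNMρ : 0 ≤ N * M * ρ := by positivity
  rcases le_or_gt (2 * l) m with hlm | hlm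
  · have hF0 : ∀ x ∈ Icc (0 : ℝ) 1, |F x| ≤ (c + 1) * M := fun x hx => by
      have h1 := abs_sub_abs_le_abs_sub (F x) (f x)
      have h2 : c * M * ρ ≤ c * M := mul_le_of_le_one_right (by positivity) hρ1
      linarith [hf x hx, hFf x hx]
    have hH0 : ∀ x ∈ Icc (0 : ℝ) 1, |H x| ≤ (c + 1) * N := fun x hx => by
      have h1 := abs_sub_abs_le_abs_sub (H x) (k x)
      have h2 : c * N * ρ ≤ c * N := mul_le_of_le_one_right (by positivity) hρ1
      linarith [hk x hx, hHk x hx]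
    have h1 := I m hm hlm H F hH hF ((c + 1) * N) ((c + 1) * M) (m ^ l * ρ) (by positivity)
      (by positivity) hmρ hH0 hF0
      (fun x hx => (hHt x hx).trans (by
        have := bw_pos hm hx
        gcongr; linarith))
      (fun x hx => (hFt x hx).trans (by
        have := bw_pos hm hx
        gcongr; linarith)) x hx
    have h2 := abs_iterate_sub_Bop_le hm l (g := (fun y => k y * f y) - fun y => H y * F y)
      (E := (c + c * (c + 1)) * (N * M) * ρ) (fun z hz => by
        simp only [Pi.sub_apply]
        rw [show k z * f z - H z * F z = -((F z - f z) * k z) + -((H z - k z) * F z) by ring]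
        refine (abs_add_le _ _).trans ?_
        rw [abs_neg, abs_neg, abs_mul, abs_mul]
        calc _ ≤ c * M * ρ * N + c * N * ρ * ((c + 1) * M) := by
              gcongr
              · exact hFf z hz
              · exact hk z hz
              · exact hHk z hz
              · exact hF0 z hz
          _ = _ := by ring) x hx
    rw [iterate_sub_Bop_eq] at h1 h2 ⊢
    rw [map_sub, Pi.sub_apply] at h2
    have h3 := abs_sub_abs_le_abs_sub (((1 - BopLin m) ^ l) (fun y => k y * f y) x)
      (((1 - BopLin m) ^ l) (fun y => H y * F y) x)
    have h4 : C * ((c + 1) * N * ((c + 1) * M)) * (m ^ l * ρ / m ^ l)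
        = C * (c + 1) ^ 2 * (N * M * ρ) := by field_simp
    have h5 : 0 ≤ 2 ^ l * (2 * l : ℝ) ^ l * (N * M * ρ) := by positivity
    linarith
  · have h1 := abs_iterate_sub_Bop_le hm l (g := fun y => k y * f y) (E := N * M)
      (fun z hz => by rw [abs_mul]; gcongr; exacts [hk z hz, hf z hz]) x hx
    have h2 : 1 ≤ (2 * l : ℝ) ^ l * ρ := hmρ.trans (by
      gcongr; exact_mod_cast hlm.le)
    have h3 : 2 ^ l * (N * M) * 1 ≤ 2 ^ l * (N * M) * ((2 * l : ℝ) ^ l * ρ) := by gcongr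
    have h4 : 0 ≤ C * (c + 1) ^ 2 * (N * M * ρ) := by positivity
    have h5 : 0 ≤ 2 ^ l * (c + c * (c + 1)) * (N * M * ρ) := by positivity
    linarith

end LinearStructure

section Steklov

/-- The Steklov average `x ↦ ∫₀¹ f (x + δ u) du`. -/
noncomputable def stek (δ : ℝ) (f : ℝ → ℝ) (x : ℝ) : ℝ := ∫ u in (0 : ℝ)..1, f (x + δ * u)

theorem continuous_stek {f : ℝ → ℝ} (hf : Continuous f) (δ : ℝ) : Continuous (stek δ f) :=
  intervalIntegral.continuous_parametric_intervalIntegral_of_continuous' (by fun_prop) 0 1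

theorem continuous_stek_iterate {f : ℝ → ℝ} (hf : Continuous f) (δ : ℝ) (n : ℕ) :
    Continuous ((stek δ)^[n] f) := by
  induction n with
  | zero => exact hf
  | succ n ih => rw [Function.iterate_succ_apply']; exact continuous_stek ih δ

theorem hasDerivAt_stek {f : ℝ → ℝ} (hf : Continuous f) {δ : ℝ} (hδ : δ ≠ 0) (x : ℝ) :
    HasDerivAt (stek δ f) (δ⁻¹ * fwdDiff δ f x) x := by
  have e : stek δ f = fun x => δ⁻¹ * ((∫ t in (0 : ℝ)..(x + δ), f t) - ∫ t in (0 : ℝ)..x, f t) := by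
    funext y
    rw [stek, intervalIntegral.integral_comp_add_mul _ hδ,
      intervalIntegral.integral_interval_sub_left (hf.intervalIntegrable _ _)
        (hf.intervalIntegrable _ _)]
    simp
  rw [e]
  have h1 : ∀ y, HasDerivAt (fun x => ∫ t in (0 : ℝ)..x, f t) (f y) y := fun y =>
    intervalIntegral.integral_hasDerivAt_right (hf.intervalIntegrable _ _)
      (hf.stronglyMeasurableAtFilter _ _) hf.continuousAt
  exact (((h1 (x + δ)).comp_add_const x δ).sub (h1 x)).const_mul _

theorem fwdDiff_stek {f : ℝ → ℝ} (hf : Continuous f) (δ h : ℝ) :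
    fwdDiff h (stek δ f) = stek δ (fwdDiff h f) := by
  funext x
  simp only [fwdDiff, stek]
  rw [← intervalIntegral.integral_sub
    (Continuous.intervalIntegrable (by fun_prop) _ _)
    (Continuous.intervalIntegrable (by fun_prop) _ _)]
  simp only [add_right_comm]

theorem continuous_fwdDiff {f : ℝ → ℝ} (hf : Continuous f) (h : ℝ) : Continuous (fwdDiff h f) := by
  unfold fwdDiff; fun_prop

theorem fwdDiff_stek_iterate {f : ℝ → ℝ} (hf : Continuous f) (δ h : ℝ) (n : ℕ) :
    fwdDiff h ((stek δ)^[n] f) = (stek δ)^[n] (fwdDiff h f) := by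
  induction n with
  | zero => rfl
  | succ n ih =>
    rw [Function.iterate_succ_apply', Function.iterate_succ_apply',
      fwdDiff_stek (continuous_stek_iterate hf δ n), ih]

theorem contDiff_stek_iterate {f : ℝ → ℝ} (hf : Continuous f) {δ : ℝ} (hδ : δ ≠ 0) (n : ℕ) :
    ContDiff ℝ n ((stek δ)^[n] f) := by
  induction n generalizing f with
  | zero => simpa using (contDiff_zero (𝕜 := ℝ)).2 hf
  | succ n ih =>
    rw [Function.iterate_succ_apply', Nat.cast_succ, contDiff_succ_iff_deriv]
    have hd := fun x => hasDerivAt_stek (continuous_stek_iterate hf δ n) hδ x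
    refine ⟨fun x => (hd x).differentiableAt, by simp, ?_⟩
    rw [show deriv (stek δ ((stek δ)^[n] f)) = fun x => δ⁻¹ * fwdDiff δ ((stek δ)^[n] f) x from
      funext fun x => (hd x).deriv, fwdDiff_stek_iterate hf]
    exact contDiff_const.mul (ih (continuous_fwdDiff hf δ))

theorem iteratedDeriv_stek_iterate {f : ℝ → ℝ} (hf : Continuous f) {δ : ℝ} (hδ : δ ≠ 0) (n : ℕ)
    (x : ℝ) : iteratedDeriv n ((stek δ)^[n] f) x = (δ ^ n)⁻¹ * (fwdDiff δ)^[n] f x := by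
  induction n generalizing f with
  | zero => simp
  | succ n ih =>
    have hd := fun x => hasDerivAt_stek (continuous_stek_iterate hf δ n) hδ x
    rw [Function.iterate_succ_apply', iteratedDeriv_succ',
      show deriv (stek δ ((stek δ)^[n] f)) = fun x => δ⁻¹ * fwdDiff δ ((stek δ)^[n] f) x from
      funext fun x => (hd x).deriv, fwdDiff_stek_iterate hf, iteratedDeriv_const_mul_field,
      ih (continuous_fwdDiff hf δ), Function.iterate_succ_apply, pow_succ, mul_inv]
    ring

theorem abs_stek_iterate_le {g : ℝ → ℝ} {δ E : ℝ} (hδ : 0 ≤ δ) (n : ℕ) {v : ℝ}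
    (h : ∀ t ∈ Icc v (v + n * δ), |g t| ≤ E) : |(stek δ)^[n] g v| ≤ E := by
  induction n generalizing v with
  | zero => exact h v (by simp)
  | succ n ih =>
    rw [Function.iterate_succ_apply', stek]
    have := intervalIntegral.norm_integral_le_of_norm_le_const (a := 0) (b := 1) (C := E)
      (f := fun u => (stek δ)^[n] g (v + δ * u)) fun u hu => by
        rw [uIoc_of_le zero_le_one] at hu
        refine ih fun t ht => h t ⟨le_trans ?_ ht.1, ht.2.trans ?_⟩
        · have : 0 ≤ δ * u := mul_nonneg hδ hu.1.le
          linarith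
        · have : δ * u ≤ δ := mul_le_of_le_one_right hδ hu.2
          push_cast; linarith
    simpa using this

theorem stek_iterate_comp (f : ℝ → ℝ) (x κ δ : ℝ) (n : ℕ) (v : ℝ) :
    (stek δ)^[n] (fun t => f (x + κ * t)) v = (stek (κ * δ))^[n] f (x + κ * v) := by
  induction n generalizing v with
  | zero => rfl
  | succ n ih =>
    rw [Function.iterate_succ_apply', Function.iterate_succ_apply', stek, stek]
    congr 1
    funext u
    rw [ih, show x + κ * (v + δ * u) = x + κ * v + κ * δ * u by ring]

theorem stek_iterate_sum {ι : Type*} (s : Finset ι) (c : ι → ℝ) (g : ι → ℝ → ℝ)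
    (hg : ∀ i ∈ s, Continuous (g i)) (δ : ℝ) (n : ℕ) :
    (stek δ)^[n] (fun t => ∑ i ∈ s, c i * g i t)
      = fun v => ∑ i ∈ s, c i * (stek δ)^[n] (g i) v := by
  induction n with
  | zero => rfl
  | succ n ih =>
    simp only [Function.iterate_succ_apply', ih]
    funext v
    simp only [stek]
    rw [intervalIntegral.integral_finsetSum]
    · simp
    · intro i hi
      have := continuous_stek_iterate (hg i hi) δ n
      exact Continuous.intervalIntegrable (by fun_prop) _ _

/-- The combination of Steklov averages used as a smoothing operator of order `r`. -/
noncomputable def smoothing (r : ℕ) (η : ℝ) (f : ℝ → ℝ) (x : ℝ) : ℝ :=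
  ∑ k ∈ Finset.range r, (-1 : ℝ) ^ k * (r.choose (k + 1) : ℝ) *
    (stek ((k + 1 : ℕ) * (η / r)))^[r] f x

theorem contDiff_smoothing {r : ℕ} (hr : 1 ≤ r) {η : ℝ} (hη : 0 < η) {f : ℝ → ℝ}
    (hf : Continuous f) : ContDiff ℝ r (smoothing r η f) := by
  unfold smoothing
  refine ContDiff.sum fun k _ => contDiff_const.mul (contDiff_stek_iterate hf ?_ r)
  positivity

theorem abs_smoothing_sub_le {r : ℕ} (hr : Even r) {η ε : ℝ} (hη : 0 ≤ η) {f : ℝ → ℝ}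
    (hf : Continuous f) {x : ℝ} (h : ∀ δ ∈ Icc 0 η, |(fwdDiff δ)^[r] f x| ≤ ε) :
    |smoothing r η f x - f x| ≤ ε := by
  rcases Nat.eq_zero_or_pos r with rfl | hr1
  · simpa [smoothing] using h 0 ⟨le_rfl, hη⟩
  have e : ∀ t, (fwdDiff t)^[r] f x
      = ∑ k ∈ Finset.range (r + 1), (-1 : ℝ) ^ k * (r.choose k : ℝ) * f (x + k * t) := fun t => by
    rw [fwdDiff_iter_eq_sum_shift]
    refine Finset.sum_congr rfl fun k hk => ?_
    have hk' : k ≤ r := Nat.lt_succ_iff.1 (Finset.mem_range.1 hk)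
    have : (-1 : ℤ) ^ (r - k) = (-1) ^ k :=
      neg_one_pow_congr (by rw [Nat.even_sub hk']; simp [hr])
    rw [this]; simp
  have key : (stek (η / r))^[r] (fun t => (fwdDiff t)^[r] f x) 0 = f x - smoothing r η f x := by
    simp_rw [e]
    rw [stek_iterate_sum _ (fun k => (-1 : ℝ) ^ k * (r.choose k : ℝ)) (fun k t => f (x + k * t))
      (fun k _ => by fun_prop)]
    simp only [stek_iterate_comp, mul_zero, add_zero]
    rw [Finset.sum_range_succ']
    have h0 : (stek 0)^[r] f x = f x := by
      have : ∀ n, (stek 0)^[n] f = f := fun n => by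
        induction n with
        | zero => rfl
        | succ n ih => rw [Function.iterate_succ_apply', ih]; funext y; simp [stek]
      rw [this]
    simp only [smoothing, Nat.cast_zero, zero_mul, h0, pow_zero, Nat.choose_zero_right,
      Nat.cast_one, one_mul, pow_succ, mul_neg, mul_one, neg_mul, Finset.sum_neg_distrib]
    ring
  rw [abs_sub_comm, ← key]
  refine abs_stek_iterate_le (by positivity) r fun t ht => h t ⟨ht.1, ht.2.trans (le_of_eq ?_)⟩
  field_simp
  ring

theorem abs_iteratedDeriv_smoothing_le {r : ℕ} (hr : 1 ≤ r) {η ε : ℝ} (hη : 0 < η) {f : ℝ → ℝ}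
    (hf : Continuous f) {x : ℝ} (h : ∀ δ ∈ Icc 0 η, |(fwdDiff δ)^[r] f x| ≤ ε) :
    |iteratedDeriv r (smoothing r η f) x| ≤ (2 * r) ^ r * ε / η ^ r := by
  have hε : 0 ≤ ε := (abs_nonneg _).trans (h 0 ⟨le_rfl, hη.le⟩)
  have hr' : (0 : ℝ) < r := by positivity
  have hcd : ∀ k : ℕ, ContDiff ℝ r ((stek ((k + 1 : ℕ) * (η / r)))^[r] f) := fun k =>
    contDiff_stek_iterate hf (by positivity) r
  have e : smoothing r η f = fun x => ∑ k ∈ Finset.range r,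
    (fun y => (-1 : ℝ) ^ k * (r.choose (k + 1) : ℝ) * (stek ((k + 1 : ℕ) * (η / r)))^[r] f y) x := rfl
  rw [e, iteratedDeriv_fun_sum (fun k _ => (contDiff_const.mul (hcd k)).contDiffAt)]
  calc _ ≤ ∑ k ∈ Finset.range r, (r.choose (k + 1) : ℝ) * ((r / η) ^ r * ε) := by
        refine (Finset.abs_sum_le_sum_abs _ _).trans (Finset.sum_le_sum fun k hk => ?_)
        have hk' : (k + 1 : ℕ) ≤ (r : ℝ) := by exact_mod_cast Finset.mem_range.1 hk
        have hk1 : (1 : ℝ) ≤ (k + 1 : ℕ) := by exact_mod_cast Nat.le_add_left 1 k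
        rw [iteratedDeriv_const_mul_field, iteratedDeriv_stek_iterate hf (by positivity), abs_mul,
          abs_mul, abs_pow, abs_neg, abs_one, one_pow, one_mul, abs_of_nonneg (by positivity),
          abs_mul, abs_of_nonneg (by positivity)]
        gcongr
        · rw [← inv_pow]
          refine pow_le_pow_left₀ (by positivity) ?_ r
          rw [← inv_div η (r : ℝ)]
          refine inv_anti₀ (by positivity) ?_
          exact le_mul_of_one_le_left (by positivity) hk1
        · refine h _ ⟨by positivity, ?_⟩
          rw [mul_div_assoc', div_le_iff₀ hr', mul_comm]
          gcongr
    _ ≤ 2 ^ r * ((r / η) ^ r * ε) := by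
        rw [← Finset.sum_mul]
        gcongr
        have := Nat.sum_range_choose r
        rw [Finset.sum_range_succ'] at this
        exact_mod_cast (by omega : ∑ k ∈ Finset.range r, r.choose (k + 1) ≤ 2 ^ r)
    _ = _ := by rw [div_pow, mul_pow]; ring

end Steklov

section Gluing

theorem exists_abs_iteratedDeriv_smoothTransition_le (r : ℕ) : ∃ B : ℝ, 1 ≤ B ∧
    ∀ i ≤ r, ∀ x, |iteratedDeriv i Real.smoothTransition x| ≤ B := by
  have single : ∀ i : ℕ, ∃ B : ℝ, 0 ≤ B ∧ ∀ x, |iteratedDeriv i Real.smoothTransition x| ≤ B := by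
    intro i
    have hc : Continuous (iteratedDeriv i Real.smoothTransition) :=
      (Real.smoothTransition.contDiff (n := (i : ℕ∞))).continuous_iteratedDeriv' i
    obtain ⟨B, hB⟩ := isCompact_Icc.exists_bound_of_continuousOn (s := Icc (0 : ℝ) 1)
      hc.continuousOn
    refine ⟨max 1 B, by positivity, fun x => ?_⟩
    rcases lt_or_ge x 0 with hx | hx
    · have : Real.smoothTransition =ᶠ[nhds x] fun _ => (0 : ℝ) := by
        filter_upwards [Iio_mem_nhds hx] with y hy
        exact Real.smoothTransition.zero_of_nonpos (le_of_lt hy)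
      rw [this.iteratedDeriv_eq, iteratedDeriv_const]
      simp
    rcases lt_or_ge 1 x with hx1 | hx1
    · have : Real.smoothTransition =ᶠ[nhds x] fun _ => (1 : ℝ) := by
        filter_upwards [Ioi_mem_nhds hx1] with y hy
        exact Real.smoothTransition.one_of_one_le (le_of_lt hy)
      rw [this.iteratedDeriv_eq, iteratedDeriv_const]
      split_ifs <;> simp
    · exact (hB x ⟨hx, hx1⟩).trans (le_max_right _ _)
  choose B hB0 hB using single
  refine ⟨1 + ∑ i ∈ Finset.range (r + 1), B i, ?_, fun i hi x => (hB i x).trans ?_⟩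
  · have := Finset.sum_nonneg fun i (_ : i ∈ Finset.range (r + 1)) => hB0 i
    linarith
  · have := Finset.single_le_sum (fun i _ => hB0 i) (Finset.mem_range.2 (Nat.lt_succ_iff.2 hi))
    linarith

/-- Smooth transition from `v` (where `b y ≤ d`) to `u` (where `b y ≥ d + 1`). -/
noncomputable def glue (b d : ℝ) (u v : ℝ → ℝ) (y : ℝ) : ℝ :=
  Real.smoothTransition (b * y - d) * u y + (1 - Real.smoothTransition (b * y - d)) * v y

theorem contDiff_cutoff (b d : ℝ) (n : ℕ) :
    ContDiff ℝ n fun y => Real.smoothTransition (b * y - d) :=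
  (Real.smoothTransition.contDiff (n := (n : ℕ∞))).comp (by fun_prop)

theorem contDiff_glue {n : ℕ} {u v : ℝ → ℝ} (hu : ContDiff ℝ n u) (hv : ContDiff ℝ n v)
    (b d : ℝ) : ContDiff ℝ n (glue b d u v) :=
  ((contDiff_cutoff b d n).mul hu).add ((contDiff_const.sub (contDiff_cutoff b d n)).mul hv)

theorem glue_eq_left {b d y : ℝ} (h : d + 1 ≤ b * y) (u v : ℝ → ℝ) : glue b d u v y = u y := by
  rw [glue, Real.smoothTransition.one_of_one_le (by linarith)]; ring

theorem glue_eq_right {b d y : ℝ} (h : b * y ≤ d) (u v : ℝ → ℝ) : glue b d u v y = v y := by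
  rw [glue, Real.smoothTransition.zero_of_nonpos (by linarith)]; ring

theorem abs_glue_sub_le {b d y ε c : ℝ} {u v : ℝ → ℝ} (hu : |u y - c| ≤ ε) (hv : |v y - c| ≤ ε) :
    |glue b d u v y - c| ≤ ε := by
  unfold glue
  set s := Real.smoothTransition (b * y - d)
  have h0 : 0 ≤ s := Real.smoothTransition.nonneg _
  have h1 : s ≤ 1 := Real.smoothTransition.le_one _
  rw [show s * u y + (1 - s) * v y - c = s * (u y - c) + (1 - s) * (v y - c) by ring]
  refine (abs_add_le _ _).trans ?_
  rw [abs_mul, abs_mul, abs_of_nonneg h0, abs_of_nonneg (by linarith : 0 ≤ 1 - s)]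
  calc _ ≤ s * ε + (1 - s) * ε := by
        have : 0 ≤ 1 - s := by linarith
        gcongr
    _ = ε := by ring

theorem exists_abs_iteratedDeriv_glue_le (r : ℕ) (D : ℝ) (hD : 1 ≤ D) : ∃ C : ℝ, 1 ≤ C ∧
    ∀ u v f : ℝ → ℝ, ContDiff ℝ r u → ContDiff ℝ r v → ∀ x L ε b d : ℝ, 0 < L → 0 ≤ ε →
    0 ≤ b → b * L ≤ 1 →
    (∀ z ∈ Icc x (x + L), |u z - f z| ≤ ε ∧ |iteratedDeriv r u z| ≤ D * ε / L ^ r) →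
    (∀ z ∈ Icc x (x + L), |v z - f z| ≤ ε ∧ |iteratedDeriv r v z| ≤ D * ε / L ^ r) →
    |iteratedDeriv r (glue b d u v) x| ≤ C * ε / L ^ r := by
  obtain ⟨B, hB, HB⟩ := exists_abs_iteratedDeriv_smoothTransition_le r
  obtain ⟨K, hK, HK⟩ := exists_intermediate_deriv_bound r
  refine ⟨2 ^ r * (B * (K * (2 * D))) + D, le_add_of_nonneg_of_le (by positivity) hD, ?_⟩
  intro u v f hu hv x L ε b d hL hε hb hbL hU hV
  have hxL : x ∈ Icc x (x + L) := ⟨le_rfl, by linarith⟩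
  have e : glue b d u v = fun y => Real.smoothTransition (b * y - d) * (u y - v y) + v y := by
    funext y; rw [glue]; ring
  have huv : ContDiff ℝ r fun y => u y - v y := hu.sub hv
  rw [e, iteratedDeriv_fun_add ((contDiff_cutoff b d r).mul huv).contDiffAt hv.contDiffAt]
  have h1 : ∀ i ≤ r, |iteratedDeriv i (fun y => Real.smoothTransition (b * y - d)) x|
      ≤ B / L ^ i := fun i hi => by
    have hsub : ContDiff ℝ i fun y => Real.smoothTransition (y - d) :=
      (Real.smoothTransition.contDiff (n := (i : ℕ∞))).comp (by fun_prop)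
    rw [iteratedDeriv_comp_const_mul (f := fun y => Real.smoothTransition (y - d)) hsub b,
      iteratedDeriv_comp_sub_const]
    simp only
    rw [abs_mul, abs_of_nonneg (by positivity), le_div_iff₀ (by positivity), mul_right_comm,
      ← mul_pow]
    calc _ ≤ 1 * B := by
          gcongr
          · exact pow_le_one₀ (by positivity) hbL
          · exact HB i hi _
      _ = B := one_mul B
  have h2 : ∀ i ≤ r, |iteratedDeriv i (fun y => u y - v y) x| ≤ K * (2 * D * ε) / L ^ i :=
    fun i hi => by
    refine HK _ huv x L (2 * D * ε) hL (by positivity) (fun z hz => ?_) (fun z hz => ?_) i hi x hxL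
    · have := abs_sub_le (u z) (f z) (v z)
      rw [abs_sub_comm (f z)] at this
      have h3 := mul_le_mul_of_nonneg_right hD hε
      linarith [(hU z hz).1, (hV z hz).1]
    · rw [iteratedDeriv_fun_sub hu.contDiffAt hv.contDiffAt]
      refine (abs_sub _ _).trans ((add_le_add (hU z hz).2 (hV z hz).2).trans (le_of_eq ?_))
      ring
  refine (abs_add_le _ _).trans ((add_le_add
    (abs_iteratedDeriv_mul_le (contDiff_cutoff b d r) huv hL h1 h2) (hV x hxL).2).trans
    (le_of_eq ?_))
  ring

/-- Successive gluing of the approximants `S 0, S 1, …` at the dyadic scales `4⁻ⁱ`. -/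
noncomputable def dyadicGlue (S : ℕ → ℝ → ℝ) : ℕ → ℝ → ℝ
  | 0 => S 0
  | i + 1 => glue (4 ^ (i + 1)) 2 (dyadicGlue S i) (S (i + 1))

theorem contDiff_dyadicGlue {n : ℕ} {S : ℕ → ℝ → ℝ} (hS : ∀ i, ContDiff ℝ n (S i)) (i : ℕ) :
    ContDiff ℝ n (dyadicGlue S i) := by
  induction i with
  | zero => exact hS 0
  | succ i ih => exact contDiff_glue ih (hS _) _ _

theorem dyadicGlue_eq (S : ℕ → ℝ → ℝ) (i : ℕ) {x : ℝ} (hx : x < 2 * (1 / 4) ^ i) :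
    dyadicGlue S i x = S i x := by
  cases i with
  | zero => rfl
  | succ i =>
    refine glue_eq_right ?_ _ _
    rw [one_div, inv_pow, ← div_eq_mul_inv, lt_div_iff₀ (by positivity)] at hx
    linarith

theorem dyadicGlue_eventuallyEq (S : ℕ → ℝ → ℝ) (i : ℕ) {x : ℝ} (hx : x < 2 * (1 / 4) ^ i) :
    dyadicGlue S i =ᶠ[nhds x] S i := by
  filter_upwards [Iio_mem_nhds hx] with y hy using dyadicGlue_eq S i hy

theorem exists_left_approx (l : ℕ) (D : ℝ) (hD : 1 ≤ D) : ∃ C : ℝ, 1 ≤ C ∧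
    ∀ (J : ℕ) (c ε : ℝ) (f : ℝ → ℝ) (S : ℕ → ℝ → ℝ), 0 < c → c ≤ 1 / 16 → 0 ≤ ε →
    (∀ i, ContDiff ℝ (2 * l : ℕ) (S i)) →
    (∀ j ≤ J, ∀ x ∈ Icc (0 : ℝ) (3 / 4), ((1 / 4) ^ (j + 1) ≤ x ∨ j = J) →
      |S j x - f x| ≤ ε ∧
        |iteratedDeriv (2 * l) (S j) x| ≤ D * ε / (c * (1 / 2) ^ J * (1 / 2) ^ j) ^ (2 * l)) →
    ∃ F : ℝ → ℝ, ContDiff ℝ (2 * l : ℕ) F ∧ ∀ x ∈ Icc (0 : ℝ) (2 / 3), |F x - f x| ≤ ε ∧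
      |iteratedDeriv (2 * l) F x|
        ≤ C * ε / ((c * (1 / 2) ^ J) ^ (2 * l) * (x + (1 / 4) ^ J) ^ l) := by
  obtain ⟨K, hK, HK⟩ := exists_abs_iteratedDeriv_glue_le (2 * l) D hD
  set E : ℝ := 3 ^ l * (K + D) with hE
  have h3l : (1 : ℝ) ≤ 3 ^ l := one_le_pow₀ (by norm_num)
  have hDE : D ≤ E := by
    rw [hE]; nlinarith
  have hE1 : 1 ≤ E := hD.trans hDE
  refine ⟨2 ^ l * E, one_le_mul_of_one_le_of_one_le (one_le_pow₀ (by norm_num)) hE1, ?_⟩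
  intro J c ε f S hc hc16 hε hS H
  set T : ℝ := (1 / 2) ^ J with hT
  have hT0 : 0 < T := by positivity
  have hpow : ∀ i : ℕ, (c * T * (1 / 2) ^ i) ^ (2 * l) = (c * T) ^ (2 * l) * ((1 / 4) ^ i) ^ l :=
    fun i => by
      rw [mul_pow, ← pow_mul, ← pow_mul, show i * (2 * l) = 2 * (i * l) by ring, pow_mul _ 2 (i * l)]
      norm_num
  have inv : ∀ i ≤ J, ∀ x, (1 / 4) ^ i ≤ x → x ≤ 2 / 3 → |dyadicGlue S i x - f x| ≤ ε ∧
      |iteratedDeriv (2 * l) (dyadicGlue S i) x| ≤ E * ε / ((c * T) ^ (2 * l) * x ^ l) := by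
    intro i
    induction i with
    | zero => intro _ x h1 h2; norm_num at h1; linarith
    | succ i ih =>
      intro hi x h1 h2
      have hx0 : 0 < x := lt_of_lt_of_le (by positivity) h1
      have hai : (1 / 4 : ℝ) ^ i = 4 * (1 / 4) ^ (i + 1) := by rw [pow_succ]; ring
      have ha0 : (0 : ℝ) < (1 / 4) ^ (i + 1) := by positivity
      have ha1 : (1 / 4 : ℝ) ^ (i + 1) ≤ 1 / 4 := by
        rw [pow_succ]
        have : (1 / 4 : ℝ) ^ i ≤ 1 := pow_le_one₀ (by norm_num) (by norm_num)
        linarith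
      have h4 : (4 : ℝ) ^ (i + 1) * (1 / 4) ^ (i + 1) = 1 := by rw [← mul_pow]; norm_num
      rcases lt_or_ge (3 * (1 / 4) ^ (i + 1)) x with hx3 | hx3
      · have hev : dyadicGlue S (i + 1) =ᶠ[nhds x] dyadicGlue S i := by
          filter_upwards [Ioi_mem_nhds hx3] with y hy
          refine glue_eq_left ?_ _ _
          have := mul_le_mul_of_nonneg_left (le_of_lt hy) (by positivity : (0 : ℝ) ≤ 4 ^ (i + 1))
          linarith
        rw [hev.iteratedDeriv_eq, hev.eq_of_nhds]
        rcases le_or_gt ((1 / 4) ^ i) x with hxi | hxi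
        · exact ih (by omega) x hxi h2
        · have hlt : x < 2 * (1 / 4) ^ i := by linarith
          rw [(dyadicGlue_eventuallyEq S i hlt).iteratedDeriv_eq, dyadicGlue_eq S i hlt]
          obtain ⟨e1, e2⟩ := H i (by omega) x ⟨hx0.le, by linarith⟩ (Or.inl h1)
          refine ⟨e1, e2.trans ?_⟩
          rw [hpow]
          gcongr
      · have hlt : x < 2 * (1 / 4) ^ i := by linarith
        have hev : dyadicGlue S (i + 1) =ᶠ[nhds x] glue (4 ^ (i + 1)) 2 (S i) (S (i + 1)) := by
          filter_upwards [dyadicGlue_eventuallyEq S i hlt] with y hy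
          simp only [dyadicGlue, glue, hy]
        rw [hev.iteratedDeriv_eq, hev.eq_of_nhds]
        set L := c * T * (1 / 2) ^ (i + 1) with hL
        have hL0 : 0 < L := by positivity
        have hL16 : L ≤ 1 / 16 := by
          have t1 : T ≤ 1 := pow_le_one₀ (by norm_num) (by norm_num)
          have t2 : (1 / 2 : ℝ) ^ (i + 1) ≤ 1 := pow_le_one₀ (by norm_num) (by norm_num)
          calc L ≤ 1 / 16 * 1 * 1 := by rw [hL]; gcongr
            _ = _ := by norm_num
        have hbL : 4 ^ (i + 1) * L ≤ 1 := by
          have t1 : (4 : ℝ) ^ (i + 1) * (1 / 2) ^ (i + 1) = 2 ^ (i + 1) := by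
            rw [← mul_pow]; norm_num
          have t2 : (2 : ℝ) ^ (i + 1) * T ≤ 1 := by
            calc _ ≤ 2 ^ J * T := by gcongr; norm_num
              _ = 1 := by rw [hT, ← mul_pow]; norm_num
          calc _ = c * (2 ^ (i + 1) * T) := by rw [hL, ← t1]; ring
            _ ≤ 1 * 1 := by gcongr; linarith
            _ = 1 := one_mul 1
        have hu : ∀ z ∈ Icc x (x + L), |S i z - f z| ≤ ε ∧
            |iteratedDeriv (2 * l) (S i) z| ≤ D * ε / L ^ (2 * l) := fun z hz => by
          obtain ⟨e1, e2⟩ := H i (by omega) z ⟨by linarith [hz.1], by linarith [hz.2]⟩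
            (Or.inl (h1.trans hz.1))
          refine ⟨e1, e2.trans ?_⟩
          gcongr
          rw [hL, pow_succ]
          have : (0 : ℝ) < (1 / 2) ^ i := by positivity
          have : 0 < c * T * (1 / 2) ^ i := by positivity
          linarith
        have hv : ∀ z ∈ Icc x (x + L), |S (i + 1) z - f z| ≤ ε ∧
            |iteratedDeriv (2 * l) (S (i + 1)) z| ≤ D * ε / L ^ (2 * l) := fun z hz =>
          H (i + 1) hi z ⟨by linarith [hz.1], by linarith [hz.2]⟩ (Or.inl (by
            rw [pow_succ]; linarith [hz.1]))
        have hxL : x ∈ Icc x (x + L) := ⟨le_rfl, by linarith⟩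
        refine ⟨abs_glue_sub_le (hu x hxL).1 (hv x hxL).1, ?_⟩
        refine (HK _ _ f (hS _) (hS _) x L ε _ 2 hL0 hε (by positivity) hbL hu hv).trans ?_
        rw [hL, hpow, div_le_div_iff₀ (by positivity) (by positivity)]
        calc K * ε * ((c * T) ^ (2 * l) * x ^ l)
            ≤ K * ε * ((c * T) ^ (2 * l) * (3 * (1 / 4) ^ (i + 1)) ^ l) := by gcongr
          _ = (3 ^ l * K) * ε * ((c * T) ^ (2 * l) * ((1 / 4) ^ (i + 1)) ^ l) := by
              generalize (1 / 4 : ℝ) ^ (i + 1) = a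
              rw [mul_pow 3 a]; ring
          _ ≤ _ := by
              gcongr
              rw [hE, mul_add]
              have : 0 ≤ 3 ^ l * D := by positivity
              linarith
  refine ⟨dyadicGlue S J, contDiff_dyadicGlue hS J, fun x hx => ?_⟩
  have hq : (0 : ℝ) < (1 / 4) ^ J := by positivity
  have fin : ∀ y, 0 < y → x + (1 / 4) ^ J ≤ 2 * y →
      E * ε / ((c * T) ^ (2 * l) * y ^ l)
        ≤ 2 ^ l * E * ε / ((c * T) ^ (2 * l) * (x + (1 / 4) ^ J) ^ l) := fun y hy hxy => by
    have hpos : 0 < x + (1 / 4) ^ J := by linarith [hx.1]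
    rw [div_le_div_iff₀ (by positivity) (by positivity)]
    calc _ ≤ E * ε * ((c * T) ^ (2 * l) * (2 * y) ^ l) := by gcongr
      _ = _ := by rw [mul_pow]; ring
  rcases le_or_gt ((1 / 4) ^ J) x with h | h
  · obtain ⟨e1, e2⟩ := inv J le_rfl x h hx.2
    exact ⟨e1, e2.trans (fin x (by linarith) (by linarith))⟩
  · have hlt : x < 2 * (1 / 4) ^ J := by linarith
    rw [(dyadicGlue_eventuallyEq S J hlt).iteratedDeriv_eq, dyadicGlue_eq S J hlt]
    obtain ⟨e1, e2⟩ := H J le_rfl x ⟨hx.1, by linarith [hx.2]⟩ (Or.inr rfl)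
    refine ⟨e1, e2.trans (le_trans ?_ (fin ((1 / 4) ^ J) hq (by linarith)))⟩
    rw [hpow]
    gcongr

end Gluing

section SmoothApproximation

theorem exists_smooth_approx_left (l : ℕ) (hl : 1 ≤ l) : ∃ C : ℝ, 1 ≤ C ∧
    ∀ (J : ℕ) (ε : ℝ) (f : ℝ → ℝ), 0 ≤ ε → Continuous f →
    (∀ a δ : ℝ, 0 ≤ a → 0 ≤ δ → a + 2 * l * δ ≤ 1 → δ ≤ (1 / 2) ^ J * phiDT (a + l * δ) →
      |(fwdDiff δ)^[2 * l] f a| ≤ ε) →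
    ∃ F : ℝ → ℝ, ContDiff ℝ (2 * l : ℕ) F ∧ ∀ x ∈ Icc (0 : ℝ) (2 / 3), |F x - f x| ≤ ε ∧
      |iteratedDeriv (2 * l) F x|
        ≤ C * ε / (((1 / 2) ^ J) ^ (2 * l) * (x + (1 / 4) ^ J) ^ l) := by
  have hl' : (1 : ℝ) ≤ l := by exact_mod_cast hl
  have hD : (1 : ℝ) ≤ (2 * (2 * l : ℕ)) ^ (2 * l) := one_le_pow₀ (by push_cast; linarith)
  obtain ⟨C, hC, H⟩ := exists_left_approx l _ hD
  set c : ℝ := 1 / (16 * l) with hcdef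
  have hc : 0 < c := by positivity
  have hcl : c * l = 1 / 16 := by rw [hcdef]; field_simp
  have hc16 : c ≤ 1 / 16 := by nlinarith
  have hcp : c ^ (2 * l) ≤ 1 := pow_le_one₀ hc.le (by linarith)
  refine ⟨C / c ^ (2 * l), (one_le_div (by positivity)).2 (hcp.trans hC), ?_⟩
  intro J ε f hε hf hω
  set T : ℝ := (1 / 2) ^ J with hT
  have hT0 : 0 < T := by positivity
  have hT1 : T ≤ 1 := pow_le_one₀ (by norm_num) (by norm_num)
  have key : ∀ j ≤ J, ∀ x ∈ Icc (0 : ℝ) (3 / 4), ((1 / 4) ^ (j + 1) ≤ x ∨ j = J) →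
      ∀ δ ∈ Icc 0 (c * T * (1 / 2) ^ j), |(fwdDiff δ)^[2 * l] f x| ≤ ε := by
    intro j _ x hx hj δ hδ
    have hδ0 := hδ.1
    have hj1 : (1 / 2 : ℝ) ^ j ≤ 1 := pow_le_one₀ (by norm_num) (by norm_num)
    have hj0 : (0 : ℝ) < (1 / 2) ^ j := by positivity
    have hδc : δ ≤ c := by
      calc δ ≤ c * T * (1 / 2) ^ j := hδ.2
        _ ≤ c * 1 * 1 := by gcongr
        _ = c := by ring
    have hlδ : l * δ ≤ 1 / 16 := by nlinarith
    have hδl : δ ≤ l * δ := by nlinarith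
    refine hω x δ hx.1 hδ0 (by linarith [hx.2]) ?_
    have hmid : 0 ≤ x + l * δ := by linarith [hx.1]
    have hmid' : (x + l * δ) / 8 ≤ (x + l * δ) * (1 - (x + l * δ)) := by nlinarith [hx.2]
    have hsq : δ ^ 2 ≤ T ^ 2 * ((x + l * δ) / 8) := by
      rcases hj with hj | rfl
      · have h4 : ((1 / 2 : ℝ) ^ j) ^ 2 = 4 * (1 / 4) ^ (j + 1) := by
          rw [pow_succ (1 / 4 : ℝ) j, ← pow_mul, mul_comm j 2, pow_mul,
            show (1 / 2 : ℝ) ^ 2 = 1 / 4 by norm_num]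
          ring
        calc δ ^ 2 ≤ (c * T * (1 / 2) ^ j) ^ 2 := by gcongr; exact hδ.2
          _ = c ^ 2 * T ^ 2 * (4 * (1 / 4) ^ (j + 1)) := by rw [mul_pow, mul_pow, h4]
          _ ≤ (1 / 16) ^ 2 * T ^ 2 * (4 * x) := by gcongr
          _ = T ^ 2 * (x / 64) := by ring
          _ ≤ _ := by gcongr ?_ * ?_; linarith [hx.1]
      · calc δ ^ 2 = δ * δ := sq δ
          _ ≤ (c * T * T) * δ := by gcongr; exact hδ.2
          _ ≤ (1 / 16 * T * T) * δ := by gcongr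
          _ = T ^ 2 * (δ / 16) := by ring
          _ ≤ _ := by gcongr ?_ * ?_; linarith [hx.1]
    refine abs_le_of_sq_le_sq' ?_ (by unfold phiDT; positivity) |>.2
    rw [mul_pow, phiDT, Real.sq_sqrt (by linarith)]
    exact hsq.trans (by gcongr)
  obtain ⟨F, hF, hF'⟩ := H J c ε f (fun j => smoothing (2 * l) (c * T * (1 / 2) ^ j) f) hc hc16 hε
    (fun i => contDiff_smoothing (by omega) (by positivity) hf) fun j hj x hx hxj =>
      ⟨abs_smoothing_sub_le (even_two_mul l) (by positivity) hf (key j hj x hx hxj),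
        abs_iteratedDeriv_smoothing_le (by omega) (by positivity) hf (key j hj x hx hxj)⟩
  refine ⟨F, hF, fun x hx => ⟨(hF' x hx).1, (hF' x hx).2.trans (le_of_eq ?_)⟩⟩
  rw [← hT, mul_pow]
  field_simp

theorem fwdDiff_iterate_comp_one_sub (l : ℕ) (f : ℝ → ℝ) (δ a : ℝ) :
    (fwdDiff δ)^[2 * l] (fun y => f (1 - y)) a = (fwdDiff δ)^[2 * l] f (1 - (a + 2 * l * δ)) := by
  rw [fwdDiff_iter_eq_sum_shift, fwdDiff_iter_eq_sum_shift, ← Finset.sum_range_reflect]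
  refine Finset.sum_congr rfl fun k hk => ?_
  have hk' : k ≤ 2 * l := Nat.lt_succ_iff.1 (Finset.mem_range.1 hk)
  have e : 2 * l + 1 - 1 - k = 2 * l - k := by omega
  rw [e, Nat.choose_symm hk', Nat.sub_sub_self hk']
  have hs : (-1 : ℤ) ^ k = (-1) ^ (2 * l - k) :=
    neg_one_pow_congr (by rw [Nat.even_sub hk']; simp)
  rw [hs]
  congr 2
  simp only [nsmul_eq_mul]
  push_cast [Nat.cast_sub hk']
  ring

/-- Smooth approximation at the scale `2⁻ᴶ φ`, from a bound on the weighted differences. -/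
theorem exists_smooth_approx (l : ℕ) (hl : 1 ≤ l) : ∃ C : ℝ, 1 ≤ C ∧
    ∀ (J : ℕ) (ε : ℝ) (f : ℝ → ℝ), 0 ≤ ε → Continuous f →
    (∀ a δ : ℝ, 0 ≤ a → 0 ≤ δ → a + 2 * l * δ ≤ 1 → δ ≤ (1 / 2) ^ J * phiDT (a + l * δ) →
      |(fwdDiff δ)^[2 * l] f a| ≤ ε) →
    ∃ F : ℝ → ℝ, ContDiff ℝ (2 * l : ℕ) F ∧ ∀ x ∈ Icc (0 : ℝ) 1, |F x - f x| ≤ ε ∧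
      |iteratedDeriv (2 * l) F x|
        ≤ C * ε / (((1 / 2) ^ J) ^ (2 * l) * (min x (1 - x) + (1 / 4) ^ J) ^ l) := by
  obtain ⟨C, hC, H⟩ := exists_smooth_approx_left l hl
  have hD : 1 ≤ C * 2 ^ l := one_le_mul_of_one_le_of_one_le hC (one_le_pow₀ (by norm_num))
  obtain ⟨K, hK, HK⟩ := exists_abs_iteratedDeriv_glue_le (2 * l) _ hD
  refine ⟨C + 2 ^ l * 12 ^ (2 * l) * K, le_add_of_le_of_nonneg hC (by positivity), ?_⟩
  intro J ε f hε hf hω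
  obtain ⟨u, hu, hu'⟩ := H J ε f hε hf hω
  obtain ⟨v, hv, hv'⟩ := H J ε (fun y => f (1 - y)) hε (by fun_prop) fun a δ ha hδ had hφ => by
    rw [fwdDiff_iterate_comp_one_sub]
    refine hω _ δ (by linarith) hδ (by linarith) (hφ.trans (le_of_eq ?_))
    congr 1
    simp only [phiDT]
    congr 1
    ring
  set T : ℝ := (1 / 2) ^ J with hT
  set q : ℝ := (1 / 4) ^ J with hq
  have hT0 : 0 < T := by positivity
  have hT1 : T ≤ 1 := pow_le_one₀ (by norm_num) (by norm_num)
  have hq0 : 0 < q := by positivity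
  have hq1 : q ≤ 1 := pow_le_one₀ (by norm_num) (by norm_num)
  set w : ℝ → ℝ := fun y => v (1 - y) with hw
  have hwc : ContDiff ℝ (2 * l : ℕ) w := hv.comp (by fun_prop)
  have hw' : ∀ x ∈ Icc (1 / 3 : ℝ) 1, |w x - f x| ≤ ε ∧ |iteratedDeriv (2 * l) w x|
        ≤ C * ε / (T ^ (2 * l) * (1 - x + q) ^ l) := fun x hx => by
    obtain ⟨e1, e2⟩ := hv' (1 - x) ⟨by linarith [hx.2], by linarith [hx.1]⟩
    refine ⟨by simpa [hw] using e1, ?_⟩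
    rw [hw, iteratedDeriv_comp_const_sub]
    simpa using e2
  have mono : ∀ x y : ℝ, 0 ≤ x → x ≤ 1 → min x (1 - x) ≤ y → C * ε / (T ^ (2 * l) * (y + q) ^ l) ≤
      (C + 2 ^ l * 12 ^ (2 * l) * K) * ε / (T ^ (2 * l) * (min x (1 - x) + q) ^ l) :=
    fun x y h0 h1 hxy => by
    have hm : 0 ≤ min x (1 - x) := le_min h0 (by linarith)
    have : 0 ≤ 2 ^ l * 12 ^ (2 * l) * K := by positivity
    gcongr
    linarith
  refine ⟨glue 12 6 w u, contDiff_glue hwc hu _ _, fun x hx => ?_⟩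
  rcases lt_or_ge x (1 / 2) with h | h
  · have hev : glue 12 6 w u =ᶠ[nhds x] u := by
      filter_upwards [Iio_mem_nhds h] with y hy
      exact glue_eq_right (by linarith [mem_Iio.1 hy]) _ _
    rw [hev.iteratedDeriv_eq, hev.eq_of_nhds]
    obtain ⟨e1, e2⟩ := hu' x ⟨hx.1, by linarith⟩
    exact ⟨e1, e2.trans (mono x x hx.1 hx.2 (min_le_left _ _))⟩
  rcases lt_or_ge (7 / 12) x with h' | h'
  · have hev : glue 12 6 w u =ᶠ[nhds x] w := by
      filter_upwards [Ioi_mem_nhds h'] with y hy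
      exact glue_eq_left (by linarith [mem_Ioi.1 hy]) _ _
    rw [hev.iteratedDeriv_eq, hev.eq_of_nhds]
    obtain ⟨e1, e2⟩ := hw' x ⟨by linarith, hx.2⟩
    exact ⟨e1, e2.trans (mono x (1 - x) hx.1 hx.2 (min_le_right _ _))⟩
  have hcrude : ∀ y : ℝ, 1 / 3 ≤ y →
      C * ε / (T ^ (2 * l) * (y + q) ^ l) ≤ C * 2 ^ l * ε / (T / 12) ^ (2 * l) := fun y hy => by
    have h1 : 1 ≤ 2 ^ l * 12 ^ (2 * l) * (y + q) ^ l := by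
      rw [pow_mul, ← mul_pow, ← mul_pow]
      exact one_le_pow₀ (by linarith)
    rw [div_pow, div_le_div_iff₀ (by positivity) (by positivity),
      ← mul_div_assoc, div_le_iff₀ (by positivity)]
    calc C * ε * T ^ (2 * l) ≤ C * ε * T ^ (2 * l) * (2 ^ l * 12 ^ (2 * l) * (y + q) ^ l) :=
          le_mul_of_one_le_right (by positivity) h1
      _ = _ := by ring
  have hzu : ∀ z ∈ Icc x (x + T / 12), |u z - f z| ≤ ε ∧
      |iteratedDeriv (2 * l) u z| ≤ C * 2 ^ l * ε / (T / 12) ^ (2 * l) := fun z hz => by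
    obtain ⟨e1, e2⟩ := hu' z ⟨by linarith [hz.1], by linarith [hz.2]⟩
    exact ⟨e1, e2.trans (hcrude z (by linarith [hz.1]))⟩
  have hzw : ∀ z ∈ Icc x (x + T / 12), |w z - f z| ≤ ε ∧
      |iteratedDeriv (2 * l) w z| ≤ C * 2 ^ l * ε / (T / 12) ^ (2 * l) := fun z hz => by
    obtain ⟨e1, e2⟩ := hw' z ⟨by linarith [hz.1], by linarith [hz.2]⟩
    exact ⟨e1, e2.trans (hcrude (1 - z) (by linarith [hz.2]))⟩
  have hxL : x ∈ Icc x (x + T / 12) := ⟨le_rfl, by linarith⟩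
  refine ⟨abs_glue_sub_le (hzw x hxL).1 (hzu x hxL).1, ?_⟩
  refine (HK w u f hwc hu x (T / 12) ε 12 6 (by positivity) hε (by norm_num) (by linarith)
    hzw hzu).trans ?_
  have hm : 0 ≤ min x (1 - x) := le_min hx.1 (by linarith [hx.2])
  have hm1 : min x (1 - x) + q ≤ 2 := by linarith [min_le_left x (1 - x), hx.2]
  rw [div_pow, div_div_eq_mul_div, div_le_div_iff₀ (by positivity) (by positivity)]
  calc K * ε * 12 ^ (2 * l) * (T ^ (2 * l) * (min x (1 - x) + q) ^ l)
      ≤ K * ε * 12 ^ (2 * l) * (T ^ (2 * l) * 2 ^ l) := by gcongr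
    _ = (0 + 2 ^ l * 12 ^ (2 * l) * K) * ε * T ^ (2 * l) := by ring
    _ ≤ _ := by gcongr; linarith

end SmoothApproximation

section ZygmundNorm

theorem abs_le_supNorm {f : ℝ → ℝ} (hf : ContinuousOn f (Icc 0 1)) {x : ℝ} (hx : x ∈ Icc (0 : ℝ) 1) :
    |f x| ≤ supNorm f := by
  obtain ⟨M, hM⟩ := isCompact_Icc.exists_bound_of_continuousOn hf
  exact le_ciSup (f := fun x : Icc (0 : ℝ) 1 => |f x|)
    ⟨M, by rintro _ ⟨y, rfl⟩; exact hM y y.2⟩ ⟨x, hx⟩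

theorem supNorm_nonneg (f : ℝ → ℝ) : 0 ≤ supNorm f := Real.iSup_nonneg fun _ => abs_nonneg _

theorem omegaDT_nonneg (r : ℕ) (f : ℝ → ℝ) (t : ℝ) : 0 ≤ omegaDT r f t :=
  Real.sSup_nonneg fun _ ⟨_, _, _, _, _, h⟩ => h ▸ abs_nonneg _

theorem sSup_zygSet_nonneg (lam : ℝ) (r : ℕ) (f : ℝ → ℝ) : 0 ≤ sSup (zygSet lam r f) :=
  Real.sSup_nonneg fun _ ⟨_, ht, h⟩ =>
    h ▸ div_nonneg (omegaDT_nonneg _ _ _) (Real.rpow_nonneg ht.le _)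

theorem Znorm_nonneg (lam : ℝ) (r : ℕ) (f : ℝ → ℝ) : 0 ≤ Znorm lam r f :=
  add_nonneg (supNorm_nonneg f) (sSup_zygSet_nonneg _ _ _)

theorem abs_le_Znorm {lam : ℝ} {r : ℕ} {f : ℝ → ℝ} (hf : memZ lam r f) {x : ℝ}
    (hx : x ∈ Icc (0 : ℝ) 1) : |f x| ≤ Znorm lam r f :=
  (abs_le_supNorm hf.1 hx).trans (le_add_of_nonneg_right (sSup_zygSet_nonneg _ _ _))

theorem abs_dtDiff_le_supNorm {r : ℕ} {h x : ℝ} {f : ℝ → ℝ} (hf : ContinuousOn f (Icc 0 1))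
    (hx : dtAdmissible r h x) :
    |dtDiff r h f x| ≤ ∑ k ∈ Finset.range (r + 1), (r.choose k : ℝ) * supNorm f := by
  refine (Finset.abs_sum_le_sum_abs _ _).trans (Finset.sum_le_sum fun k hk => ?_)
  rw [abs_mul, abs_mul, abs_pow, abs_neg, abs_one, one_pow, one_mul, Nat.abs_cast]
  gcongr
  exact abs_le_supNorm hf (hx.2 k (Nat.lt_succ_iff.1 (Finset.mem_range.1 hk)))

theorem abs_dtDiff_le {lam : ℝ} {r : ℕ} {f : ℝ → ℝ} (hf : memZ lam r f) {h x : ℝ} (hh : 0 < h)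
    (hx : dtAdmissible r h x) : |dtDiff r h f x| ≤ Znorm lam r f * h ^ lam := by
  have h1 : |dtDiff r h f x| ≤ omegaDT r f h := le_csSup
    ⟨∑ k ∈ Finset.range (r + 1), (r.choose k : ℝ) * supNorm f, by
      rintro _ ⟨h', x', -, -, hx', rfl⟩; exact abs_dtDiff_le_supNorm hf.1 hx'⟩
    ⟨h, x, hh, le_rfl, hx, rfl⟩
  have h2 : omegaDT r f h / h ^ lam ≤ sSup (zygSet lam r f) := le_csSup hf.2 ⟨h, hh, rfl⟩
  have h3 : omegaDT r f h / h ^ lam ≤ Znorm lam r f :=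
    h2.trans (le_add_of_nonneg_left (supNorm_nonneg f))
  exact h1.trans ((div_le_iff₀ (by positivity)).1 h3)

theorem abs_fwdDiff_iterate_le_Znorm {lam : ℝ} (hlam : 0 < lam) {l : ℕ} (hl : 1 ≤ l)
    {f g : ℝ → ℝ} (hf : memZ lam (2 * l) f) (hg : EqOn g f (Icc 0 1)) {T : ℝ} (hT : 0 < T)
    {a δ : ℝ} (ha : 0 ≤ a) (hδ : 0 ≤ δ) (haδ : a + 2 * l * δ ≤ 1)
    (hφ : δ ≤ T * phiDT (a + l * δ)) :
    |(fwdDiff δ)^[2 * l] g a| ≤ Znorm lam (2 * l) f * T ^ lam := by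
  have hN := Znorm_nonneg lam (2 * l) f
  rcases hδ.eq_or_lt with rfl | hδ
  · obtain ⟨n, hn⟩ : ∃ n, 2 * l = n + 1 := ⟨2 * l - 1, by omega⟩
    rw [hn, Function.iterate_succ_apply', fwdDiff, ← hn]
    simp only [add_zero, sub_self, abs_zero]
    positivity
  have hφ0 : 0 < phiDT (a + l * δ) := pos_of_mul_pos_right (hδ.trans_le hφ) hT.le
  set h := δ / phiDT (a + l * δ) with hh
  have hh0 : 0 < h := by positivity
  have hhT : h ≤ T := (div_le_iff₀ hφ0).2 hφ
  have hhφ : h / 2 * phiDT (a + l * δ) = δ / 2 := by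
    rw [hh, div_right_comm, div_mul_cancel₀ _ hφ0.ne']
  have node : ∀ k : ℕ, a + l * δ + (((2 * l : ℕ) : ℝ) - 2 * k) * (h / 2) * phiDT (a + l * δ)
      = a + (2 * l - k) * δ := fun k => by
    rw [mul_assoc, hhφ]; push_cast; ring
  have nodemem : ∀ k ≤ 2 * l, a + (2 * l - (k : ℝ)) * δ ∈ Icc (0 : ℝ) 1 := fun k hk => by
    have hk' : (k : ℝ) ≤ 2 * l := by exact_mod_cast hk
    have h1 : 0 ≤ (2 * l - (k : ℝ)) * δ := mul_nonneg (by linarith) hδ.le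
    have h2 : 0 ≤ (k : ℝ) * δ := by positivity
    constructor <;> nlinarith
  have hadm : dtAdmissible (2 * l) h (a + l * δ) := by
    refine ⟨?_, fun k hk => by rw [node]; exact nodemem k hk⟩
    have h2 : 0 ≤ (l : ℝ) * δ := by positivity
    constructor <;> nlinarith
  have e : (fwdDiff δ)^[2 * l] g a = dtDiff (2 * l) h f (a + l * δ) := by
    rw [fwdDiff_iter_eq_sum_shift, ← Finset.sum_range_reflect, dtDiff]
    refine Finset.sum_congr rfl fun k hk => ?_
    have hk' : k ≤ 2 * l := Nat.lt_succ_iff.1 (Finset.mem_range.1 hk)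
    have e : 2 * l + 1 - 1 - k = 2 * l - k := by omega
    rw [e, Nat.choose_symm hk', Nat.sub_sub_self hk', node, ← hg (nodemem k hk')]
    simp only [nsmul_eq_mul, zsmul_eq_mul]
    push_cast [Nat.cast_sub hk']
    ring
  rw [e]
  refine (abs_dtDiff_le hf hh0 hadm).trans ?_
  gcongr

theorem exists_smooth_approx_of_memZ (l : ℕ) (hl : 1 ≤ l) : ∃ C : ℝ, 0 ≤ C ∧
    ∀ lam : ℝ, 0 < lam → lam ≤ 2 * l → ∀ f : ℝ → ℝ, memZ lam (2 * l) f → ∀ m : ℕ, 1 ≤ m →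
    ∃ F : ℝ → ℝ, ContDiff ℝ (2 * l : ℕ) F ∧ ∀ x ∈ Icc (0 : ℝ) 1,
      |F x - f x| ≤ C * Znorm lam (2 * l) f * (m : ℝ) ^ (-(lam / 2)) ∧
      |iteratedDeriv (2 * l) F x| ≤
        C * Znorm lam (2 * l) f * ((m : ℝ) ^ l * (m : ℝ) ^ (-(lam / 2))) / bw m x ^ l := by
  obtain ⟨C, hC, H⟩ := exists_smooth_approx l hl
  refine ⟨C * 2 ^ (2 * l), by positivity, fun lam hlam hlam2 f hf m hm => ?_⟩
  set N := Znorm lam (2 * l) f with hNdef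
  have hN : 0 ≤ N := Znorm_nonneg _ _ _
  have hm0 : (0 : ℝ) < m := by positivity
  set J := Nat.log 4 m with hJ
  have hJ1 : (4 : ℝ) ^ J ≤ m := by exact_mod_cast Nat.pow_log_le_self 4 (by omega : m ≠ 0)
  have hJ2 : (m : ℝ) < 4 * 4 ^ J := by
    have := Nat.lt_pow_succ_log_self (by norm_num : 1 < 4) m
    rw [pow_succ'] at this
    exact_mod_cast this
  set T : ℝ := (1 / 2) ^ J with hT
  set ρ : ℝ := (m : ℝ) ^ (-(lam / 2)) with hρ
  have hρ0 : 0 < ρ := by positivity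
  have hT0 : 0 < T := by positivity
  have hT2 : T ^ 2 = (1 / 4) ^ J := by
    rw [hT, ← pow_mul, mul_comm, pow_mul]; norm_num
  have hT4 : T ^ 2 * 4 ^ J = 1 := by rw [hT2, ← mul_pow]; norm_num
  have hTρ : T ^ lam ≤ 2 ^ (2 * l) * ρ := by
    have h1 : T ^ 2 ≤ 4 / m := by
      rw [le_div_iff₀ hm0]
      nlinarith [sq_nonneg T]
    calc T ^ lam = (T ^ 2) ^ (lam / 2) := by
          rw [← Real.rpow_natCast, ← Real.rpow_mul hT0.le]; congr 1; push_cast; ring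
      _ ≤ (4 / m) ^ (lam / 2) := by gcongr
      _ = 2 ^ lam * ρ := by
          rw [Real.div_rpow (by norm_num) hm0.le, hρ, Real.rpow_neg hm0.le, div_eq_mul_inv,
            show (4 : ℝ) = 2 ^ (2 : ℝ) by norm_num, ← Real.rpow_mul (by norm_num)]
          congr 2; ring
      _ ≤ 2 ^ ((2 * l : ℕ) : ℝ) * ρ := by
          gcongr
          · norm_num
          · push_cast; exact hlam2
      _ = _ := by rw [Real.rpow_natCast]
  obtain ⟨F, hF, hF'⟩ := H J (N * T ^ lam) (IccExtend zero_le_one ((Icc (0 : ℝ) 1).domRestrict f))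
    (by positivity) (Continuous.Icc_extend' hf.1.domRestrict) fun a δ ha hδ haδ hφ =>
      abs_fwdDiff_iterate_le_Znorm hlam hl hf
        (fun x hx => by rw [IccExtend_of_mem _ _ hx]; rfl) hT0 ha hδ haδ hφ
  refine ⟨F, hF, fun x hx => ?_⟩
  obtain ⟨e1, e2⟩ := hF' x hx
  rw [IccExtend_of_mem _ _ hx] at e1
  constructor
  · calc |F x - f x| ≤ N * T ^ lam := e1
      _ ≤ N * (2 ^ (2 * l) * ρ) := by gcongr
      _ = 1 * (2 ^ (2 * l) * N * ρ) := by ring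
      _ ≤ C * (2 ^ (2 * l) * N * ρ) := by gcongr
      _ = _ := by ring
  · have hbw : bw m x ≤ min x (1 - x) + (1 / 4) ^ J := by
      rw [bw, ← hT2]
      gcongr
      rw [div_le_iff₀ hm0]
      nlinarith [sq_nonneg T]
    have hb0 := bw_pos hm hx
    have hTm : 1 ≤ T ^ (2 * l) * (m : ℝ) ^ l := by
      rw [pow_mul, ← mul_pow]
      refine one_le_pow₀ ?_
      nlinarith [sq_nonneg T]
    refine e2.trans ?_
    rw [← hT]
    calc C * (N * T ^ lam) / (T ^ (2 * l) * (min x (1 - x) + (1 / 4) ^ J) ^ l)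
        ≤ C * (N * (2 ^ (2 * l) * ρ)) / (T ^ (2 * l) * bw m x ^ l) := by gcongr
      _ ≤ _ := by
        rw [div_le_div_iff₀ (by positivity) (by positivity)]
        calc C * (N * (2 ^ (2 * l) * ρ)) * bw m x ^ l
            ≤ C * (N * (2 ^ (2 * l) * ρ)) * bw m x ^ l * (T ^ (2 * l) * (m : ℝ) ^ l) :=
              le_mul_of_one_le_right (by positivity) hTm
          _ = _ := by ring

theorem exists_abs_iterate_sub_Bop_le_Znorm (l : ℕ) (hl : 1 ≤ l) : ∃ C : ℝ, 0 ≤ C ∧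
    ∀ lam : ℝ, 0 < lam → lam ≤ 2 * l → ∀ f g : ℝ → ℝ, memZ lam (2 * l) f → memZ lam (2 * l) g →
    ∀ m : ℕ, 1 ≤ m → ∀ x ∈ Icc (0 : ℝ) 1,
      |((fun h => h - Bop m h)^[l] fun y => g y * f y) x|
        ≤ C * (Znorm lam (2 * l) g * Znorm lam (2 * l) f) * (m : ℝ) ^ (-(lam / 2)) := by
  obtain ⟨c, hc, H⟩ := exists_smooth_approx_of_memZ l hl
  obtain ⟨C, hC, HC⟩ := exists_abs_iterate_sub_Bop_le_of_approx l hl c hc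
  refine ⟨C, hC, fun lam hlam hlam2 f g hf hg m hm => ?_⟩
  obtain ⟨F, hF, hF'⟩ := H lam hlam hlam2 f hf m hm
  obtain ⟨G, hG, hG'⟩ := H lam hlam hlam2 g hg m hm
  have hm1 : (1 : ℝ) ≤ m := by exact_mod_cast hm
  have hm0 : (0 : ℝ) < m := by positivity
  refine HC m hm _ (by positivity) (Real.rpow_le_one_of_one_le_of_nonpos hm1 (by linarith)) ?_
    f g F G hF hG _ _ (fun x hx => abs_le_Znorm hf hx) (fun x hx => abs_le_Znorm hg hx)
    (fun x hx => (hF' x hx).1) (fun x hx => (hG' x hx).1)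
    (fun x hx => (hF' x hx).2) (fun x hx => (hG' x hx).2)
  rw [← Real.rpow_natCast, ← Real.rpow_add hm0]
  exact Real.one_le_rpow hm1 (by linarith)

end ZygmundNorm

section Quadrature

theorem sum_bern_smul (m : ℕ) (g : ℝ → ℝ) :
    ∑ j ∈ Finset.range (m + 1), g ((j : ℝ) / m) • bern m j = BopLin m g := by
  funext x
  simp only [Finset.sum_apply, Pi.smul_apply, smul_eq_mul]
  exact Finset.sum_congr rfl fun j _ => mul_comm _ _

theorem one_sub_BopLin_pow_apply (m l : ℕ) (g : ℝ → ℝ) (x : ℝ) :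
    ((1 - BopLin m) ^ l) g x
      = ∑ i ∈ Finset.range (l + 1), (-1 : ℝ) ^ i * (l.choose i : ℝ) * ((BopLin m ^ i) g x) := by
  rw [sub_eq_neg_add, ← neg_one_smul ℝ (BopLin m), (Commute.one_right _).add_pow,
    LinearMap.sum_apply, Finset.sum_apply]
  refine Finset.sum_congr rfl fun i _ => ?_
  rw [one_pow, mul_one, smul_pow, ← nsmul_eq_mul', LinearMap.smul_apply, LinearMap.smul_apply,
    Pi.smul_apply, Pi.smul_apply, nsmul_eq_mul, smul_eq_mul]
  ring

/-- The fundamental polynomials represent the generalized Bernstein operator. -/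
theorem sum_gbBasis_mul (m l : ℕ) (g : ℝ → ℝ) (x : ℝ) :
    ∑ j ∈ Finset.range (m + 1), gbBasis m l j x * g ((j : ℝ) / m)
      = g x - ((fun h => h - Bop m h)^[l] g) x := by
  have hpow : ∀ i, ∑ j ∈ Finset.range (m + 1), (Bop m)^[i] (bern m j) x * g ((j : ℝ) / m)
      = (BopLin m ^ (i + 1)) g x := fun i => by
    rw [pow_succ, Module.End.mul_apply, ← sum_bern_smul, map_sum, Finset.sum_apply]
    refine Finset.sum_congr rfl fun j _ => ?_
    rw [map_smul, Pi.smul_apply, smul_eq_mul, mul_comm, Module.End.coe_pow]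
    rfl
  rw [iterate_sub_Bop_eq, one_sub_BopLin_pow_apply, Finset.range_eq_Ico (a := l + 1),
    Finset.sum_eq_sum_Ico_succ_bot (by omega : 0 < l + 1), zero_add, Finset.Ico_add_one_right_eq_Icc]
  simp only [gbBasis, Finset.sum_mul]
  rw [Finset.sum_comm, pow_zero, pow_zero, Nat.choose_zero_right, Nat.cast_one, one_mul, one_mul,
    Module.End.one_apply, sub_add_cancel_left, ← Finset.sum_neg_distrib]
  refine Finset.sum_congr rfl fun i hi => ?_
  obtain ⟨n, rfl⟩ : ∃ n, i = n + 1 := ⟨i - 1, by have := (Finset.mem_Icc.1 hi).1; omega⟩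
  rw [← hpow, Finset.mul_sum, ← Finset.sum_neg_distrib]
  refine Finset.sum_congr rfl fun j _ => ?_
  rw [Nat.add_sub_cancel, pow_succ]
  ring

theorem continuous_gbBasis (m l j : ℕ) : Continuous (gbBasis m l j) := by
  refine continuous_finsetSum _ fun i _ => continuous_const.mul ?_
  cases i - 1 with
  | zero => unfold bern; simp only [Function.iterate_zero, id]; fun_prop
  | succ n =>
    rw [Function.iterate_succ_apply']
    exact (contDiff_Bop (n := 0) m _).continuous

theorem intervalIntegrable_beta_weight {alp bet : ℝ} (halp : -1 < alp) (hbet : -1 < bet) :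
    IntervalIntegrable (fun t : ℝ => (1 - t) ^ alp * t ^ bet) volume 0 1 := by
  have half : ∀ a b : ℝ, -1 < b →
      IntervalIntegrable (fun t : ℝ => (1 - t) ^ a * t ^ b) volume 0 (1 / 2) := fun a b hb => by
    refine (intervalIntegral.intervalIntegrable_rpow' hb).continuousOn_mul ?_
    rw [uIcc_of_le (by norm_num)]
    refine ContinuousOn.rpow_const (by fun_prop) fun t ht => Or.inl ?_
    linarith [ht.2]
  refine (half alp bet hbet).trans ?_
  have h := ((half bet alp halp).comp_sub_left 1).symm
  norm_num at h
  simpa [mul_comm] using h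

theorem exists_integral_weight_le {alp bet : ℝ} (halp : -1 < alp) (hbet : -1 < bet)
    (hab : 0 ≤ alp + bet + 1) : ∃ W : ℝ, 0 ≤ W ∧ ∀ s ∈ Icc (0 : ℝ) 1,
    IntervalIntegrable (fun t : ℝ => (s - t) ^ alp * t ^ bet) volume 0 s ∧
      ∫ t in (0 : ℝ)..s, (s - t) ^ alp * t ^ bet ≤ W := by
  have h1 := intervalIntegrable_beta_weight halp hbet
  have hW : 0 ≤ ∫ t in (0 : ℝ)..1, (1 - t) ^ alp * t ^ bet :=
    intervalIntegral.integral_nonneg zero_le_one fun t ht =>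
      mul_nonneg (Real.rpow_nonneg (by linarith [ht.2]) _) (Real.rpow_nonneg ht.1 _)
  refine ⟨_, hW, fun s hs => ?_⟩
  rcases hs.1.eq_or_lt with rfl | hs0
  · simpa using hW
  have hscale : EqOn (fun t : ℝ => s ^ alp * s ^ bet * ((1 - t) ^ alp * t ^ bet))
      (fun t => (s - s * t) ^ alp * (s * t) ^ bet) (uIcc 0 1) := fun t ht => by
    rw [uIcc_of_le zero_le_one] at ht
    simp only
    rw [show s - s * t = s * (1 - t) by ring, Real.mul_rpow hs0.le (by linarith [ht.2]),
      Real.mul_rpow hs0.le ht.1]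
    ring
  constructor
  · have h2 : IntervalIntegrable (fun t => (s - s * t) ^ alp * (s * t) ^ bet) volume 0 1 :=
      (h1.const_mul (s ^ alp * s ^ bet)).congr (hscale.mono uIoc_subset_uIcc)
    rw [← IntervalIntegrable.comp_mul_left_iff hs0.ne', zero_div, div_self hs0.ne']
    exact h2
  · have h2 := intervalIntegral.mul_integral_comp_mul_left (a := 0) (b := 1)
      (f := fun t => (s - t) ^ alp * t ^ bet) s
    rw [mul_zero, mul_one] at h2
    rw [← h2, ← intervalIntegral.integral_congr hscale, intervalIntegral.integral_const_mul,
      ← mul_assoc]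
    refine mul_le_of_le_one_left hW ?_
    calc s * (s ^ alp * s ^ bet) = s ^ (alp + bet + 1) := by
          rw [Real.rpow_add hs0, Real.rpow_add hs0, Real.rpow_one]; ring
      _ ≤ 1 := Real.rpow_le_one hs0.le hs.2 hab

theorem Vop_sub_Vmop_eq {alp bet s : ℝ} {k : ℝ → ℝ → ℝ} {f : ℝ → ℝ} (m l : ℕ)
    (hs : s ∈ Icc (0 : ℝ) 1) (hk : ContinuousOn (fun t => k t s) (Icc 0 1))
    (hf : ContinuousOn f (Icc 0 1))
    (hw : IntervalIntegrable (fun t : ℝ => (s - t) ^ alp * t ^ bet) volume 0 s) :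
    Vop alp bet k f s - Vmop alp bet k m l f s
      = ∫ t in (0 : ℝ)..s, ((fun h => h - Bop m h)^[l] fun t => k t s * f t) t *
          ((s - t) ^ alp * t ^ bet) := by
  have hsub : uIcc 0 s ⊆ Icc (0 : ℝ) 1 := by
    rw [uIcc_of_le hs.1]; exact Icc_subset_Icc_right hs.2
  have hQ : ∀ j, IntervalIntegrable (fun t => gbBasis m l j t * ((s - t) ^ alp * t ^ bet))
      volume 0 s := fun j => hw.continuousOn_mul (continuous_gbBasis m l j).continuousOn
  have hV : Vmop alp bet k m l f s = ∫ t in (0 : ℝ)..s, ∑ j ∈ Finset.range (m + 1),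
      gbBasis m l j t * ((s - t) ^ alp * t ^ bet) * (k ((j : ℝ) / m) s * f ((j : ℝ) / m)) := by
    rw [intervalIntegral.integral_finsetSum fun j _ => (hQ j).mul_const _]
    refine Finset.sum_congr rfl fun j _ => ?_
    rw [intervalIntegral.integral_mul_const, Qcoef, mul_assoc (intervalIntegral _ _ _ _)]
    simp only [mul_assoc]
  rw [hV, Vop, ← intervalIntegral.integral_sub]
  · refine intervalIntegral.integral_congr fun t _ => ?_
    have e := sum_gbBasis_mul m l (fun t => k t s * f t) t
    rw [eq_sub_iff_add_eq', ← eq_sub_iff_add_eq] at e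
    rw [e, sub_mul, Finset.sum_mul]
    congr 1
    · ring
    · exact Finset.sum_congr rfl fun j _ => by ring
  · have := hw.continuousOn_mul ((hk.mul hf).mono hsub)
    simpa only [mul_assoc, Pi.mul_apply] using this
  · have := IntervalIntegrable.sum (Finset.range (m + 1)) fun j _ =>
      (hQ j).mul_const (k ((j : ℝ) / m) s * f ((j : ℝ) / m))
    exact this.congr fun t _ => by simp only [Finset.sum_apply]

end Quadrature

/-- uniform error estimate for the discrete Volterra operator. -/
theorem volterra_quadrature_error (l : ℕ) (hl : 1 ≤ l) (lam : ℝ) (hlam : 0 < lam)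
    (hlam2 : lam ≤ 2 * (l : ℝ)) (alp bet : ℝ) (halp : -1 < alp) (hbet : -1 < bet)
    (hab : 0 ≤ alp + bet + 1) (k : ℝ → ℝ → ℝ)
    (hk : ContinuousOn (Function.uncurry k) (Set.Icc 0 1 ×ˢ Set.Icc 0 1))
    (hks : ∀ s ∈ Set.Icc (0 : ℝ) 1, memZ lam (2 * l) (fun t => k t s))
    (hkb : BddAbove {y | ∃ s ∈ Set.Icc (0 : ℝ) 1, y = Znorm lam (2 * l) (fun t => k t s)}) :
    ∃ C > 0, ∀ f : ℝ → ℝ, memZ lam (2 * l) f → ∀ m : ℕ, 1 ≤ m →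
      supNorm (fun s => Vop alp bet k f s - Vmop alp bet k m l f s) ≤
        C * sSup {y | ∃ s ∈ Set.Icc (0 : ℝ) 1, y = Znorm lam (2 * l) (fun t => k t s)} *
          ((m : ℝ) ^ (-(lam / 2)) + (m : ℝ) ^ (-(l : ℝ))) * Znorm lam (2 * l) f := by
  obtain ⟨C, hC, H⟩ := exists_abs_iterate_sub_Bop_le_Znorm l hl
  obtain ⟨W, hW, HW⟩ := exists_integral_weight_le halp hbet hab
  refine ⟨C * W + 1, by positivity, fun f hf m hm => ?_⟩
  set K := sSup {y | ∃ s ∈ Icc (0 : ℝ) 1, y = Znorm lam (2 * l) (fun t => k t s)} with hKdef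
  have hK : 0 ≤ K := Real.sSup_nonneg fun _ ⟨_, _, h⟩ => h ▸ Znorm_nonneg _ _ _
  set N := Znorm lam (2 * l) f with hNdef
  have hN : 0 ≤ N := Znorm_nonneg _ _ _
  have hρ : 0 ≤ (m : ℝ) ^ (-(lam / 2)) := by positivity
  have hρ' : 0 ≤ (m : ℝ) ^ (-(l : ℝ)) := by positivity
  refine ciSup_le fun ⟨s, hs⟩ => ?_
  obtain ⟨hw, hwW⟩ := HW s hs
  have hsK : Znorm lam (2 * l) (fun t => k t s) ≤ K := le_csSup hkb ⟨s, hs, rfl⟩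
  beta_reduce
  rw [Vop_sub_Vmop_eq m l hs (hks s hs).1 hf.1 hw, ← Real.norm_eq_abs]
  calc _ ≤ ∫ t in (0 : ℝ)..s, C * (K * N) * (m : ℝ) ^ (-(lam / 2)) *
        ((s - t) ^ alp * t ^ bet) := by
        refine intervalIntegral.norm_integral_le_of_norm_le hs.1
          (Filter.Eventually.of_forall fun t ht => ?_) (hw.const_mul _)
        have ht0 : 0 ≤ (s - t) ^ alp * t ^ bet :=
          mul_nonneg (Real.rpow_nonneg (by linarith [ht.2]) _) (Real.rpow_nonneg ht.1.le _)
        rw [norm_mul, Real.norm_of_nonneg ht0, Real.norm_eq_abs]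
        refine mul_le_mul_of_nonneg_right ?_ ht0
        refine (H lam hlam hlam2 f _ hf (hks s hs) m hm t ⟨ht.1.le, ht.2.trans hs.2⟩).trans ?_
        gcongr
    _ = C * (K * N) * (m : ℝ) ^ (-(lam / 2)) * ∫ t in (0 : ℝ)..s, (s - t) ^ alp * t ^ bet :=
        intervalIntegral.integral_const_mul _ _
    _ ≤ C * (K * N) * (m : ℝ) ^ (-(lam / 2)) * W := by gcongr
    _ = C * W * K * (m : ℝ) ^ (-(lam / 2)) * N := by ring
    _ ≤ _ := by
        gcongr ?_ * _ * ?_ * _ <;> linarith
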